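/- Let X ⊂ P^4 be a threefold covered by lines, whose Fano scheme Σ is generically reduced and of dimension 2. Then μ ≤ 6; i.e., through a general point of X there pass at most 6 lines contained in X. -/

import Mathlib

open MvPolynomial

noncomputable section

namespace PaperLines

variable (K : Type) [Field K]

/-- Projective `N`-space over `K`, as the projectivization of `K^{N+1}`. -/
abbrev PP (N : ℕ) := Projectivization K (Fin (N + 1) → K)

/-- The zero locus in `ℙ^N` of a (homogeneous) polynomial. -/
def projZeros {N : ℕ} (F : MvPolynomial (Fin (N + 1)) K) : Set (PP K N) :=
  {x | ∀ v ∈ x.submodule, eval v F = 0}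

/-- The projective linear subspace associated to a linear subspace `W ⊆ K^{N+1}`. -/
def projLinear {N : ℕ} (W : Submodule K (Fin (N + 1) → K)) : Set (PP K N) :=
  {x | x.submodule ≤ W}

/-- The Grassmannian of `k`-dimensional linear subspaces of `K^{N+1}`
(`k = 2` gives the lines of `ℙ^N`, `k = 3` the planes). -/
def Grass (k N : ℕ) := {W : Submodule K (Fin (N + 1) → K) // Module.finrank K W = k}

/-- The set of lines contained in the hypersurface `{F = 0} ⊆ ℙ^N`. -/
def fanoSet {N : ℕ} (F : MvPolynomial (Fin (N + 1)) K) : Set (Grass K 2 N) :=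
  {W | projLinear K W.1 ⊆ projZeros K F}

/-- `X = {F = 0}` is covered by lines. -/
def CoveredByLines {N : ℕ} (F : MvPolynomial (Fin (N + 1)) K) : Prop :=
  ∀ x ∈ projZeros K F, ∃ W ∈ fanoSet K F, x ∈ projLinear K W.1

/-- The ideal of polynomials vanishing on a subset of affine space `K^σ`. -/
def affVanishing {σ : Type} (S : Set (σ → K)) : Ideal (MvPolynomial σ K) where
  carrier := {f | ∀ v ∈ S, eval v f = 0}
  add_mem' := by
    intro a b ha hb v hv
    simp only [map_add, ha v hv, hb v hv, add_zero]
  zero_mem' := by intro v hv; simp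
  smul_mem' := by
    intro c a ha v hv
    simp only [smul_eq_mul, map_mul, ha v hv, mul_zero]

/-- The dimension of a subset of affine space `K^σ`, as the Krull dimension of its
coordinate ring (this only depends on the Zariski closure). -/
def affDim {σ : Type} (S : Set (σ → K)) : WithBot ℕ∞ :=
  ringKrullDim (MvPolynomial σ K ⧸ affVanishing K S)

/-- The affine cone over a subset of `ℙ^N`. -/
def projCone {N : ℕ} (S : Set (PP K N)) : Set (Fin (N + 1) → K) :=
  {v | ∃ x ∈ S, v ∈ x.submodule}

/-- A subset of `ℙ^N` has (projective) dimension `d`:  its affine cone has dimension `d+1`. -/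
def HasProjDim {N : ℕ} (S : Set (PP K N)) (d : ℕ) : Prop :=
  affDim K (projCone K S) = ((d + 1 : ℕ) : WithBot ℕ∞)

/-- A subset of `ℙ^N` has (projective) dimension at most `d`. -/
def ProjDimLE {N : ℕ} (S : Set (PP K N)) (d : ℕ) : Prop :=
  affDim K (projCone K S) ≤ ((d + 1 : ℕ) : WithBot ℕ∞)

/-- A subset of `ℙ^N` has (projective) dimension at least `d`. -/
def ProjDimGE {N : ℕ} (S : Set (PP K N)) (d : ℕ) : Prop :=
  ((d + 1 : ℕ) : WithBot ℕ∞) ≤ affDim K (projCone K S)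

/-- A `k`-tuple of vectors (a "frame") all lying in the subspace `W`. -/
def frameMem {k N : ℕ} (p : Fin k × Fin (N + 1) → K) (W : Submodule K (Fin (N + 1) → K)) : Prop :=
  ∀ i : Fin k, (fun j => p (i, j)) ∈ W

/-- The "Stiefel cone" over a family of `k`-planes: all `k`-tuples of vectors lying in some
member of the family.  Over a `d`-dimensional family it has dimension `d + k²`. -/
def frameCone (k N : ℕ) (S : Set (Grass K k N)) : Set (Fin k × Fin (N + 1) → K) :=
  {p | ∃ W ∈ S, frameMem K p W.1}

/-- A family of `k`-planes has dimension `d` (computed via its Stiefel cone). -/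
def HasGrDim {k N : ℕ} (S : Set (Grass K k N)) (d : ℕ) : Prop :=
  affDim K (frameCone K k N S) = ((d + k * k : ℕ) : WithBot ℕ∞)

/-- A family of `k`-planes has dimension at least `d`. -/
def GrDimGE {k N : ℕ} (S : Set (Grass K k N)) (d : ℕ) : Prop :=
  ((d + k * k : ℕ) : WithBot ℕ∞) ≤ affDim K (frameCone K k N S)

/-- Zariski-closed subsets of the Grassmannian: common zero sets of families of polynomials
in frame coordinates (vanishing being required for every frame). -/
def GrClosed {k N : ℕ} (S : Set (Grass K k N)) : Prop :=
  ∃ 𝒢 : Set (MvPolynomial (Fin k × Fin (N + 1)) K),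
    S = {W | ∀ G ∈ 𝒢, ∀ p, frameMem K p W.1 → eval p G = 0}

/-- The Zariski closure of a family of `k`-planes in the Grassmannian. -/
def grClosure {k N : ℕ} (S : Set (Grass K k N)) : Set (Grass K k N) :=
  ⋂₀ {C | GrClosed K C ∧ S ⊆ C}

/-- Irreducibility of a family of `k`-planes. -/
def GrIrred {k N : ℕ} (S : Set (Grass K k N)) : Prop :=
  S.Nonempty ∧ ∀ C₁ C₂, GrClosed K C₁ → GrClosed K C₂ → S ⊆ C₁ ∪ C₂ → S ⊆ C₁ ∨ S ⊆ C₂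

/-- `S` is an irreducible component of `T` (a maximal irreducible subset). -/
def IsGrComponentOf {k N : ℕ} (S T : Set (Grass K k N)) : Prop :=
  S ⊆ T ∧ GrIrred K S ∧ ∀ S', S ⊆ S' → S' ⊆ T → GrIrred K S' → S' = S

/-- A property `P` holds for a general member of the family `S` of `k`-planes:
it holds on a nonempty principal open subset of `S`. -/
def GenerallyOnGr {k N : ℕ} (S : Set (Grass K k N)) (P : Grass K k N → Prop) : Prop :=
  ∃ G : MvPolynomial (Fin k × Fin (N + 1)) K,
    (∃ W ∈ S, ∃ p, frameMem K p W.1 ∧ eval p G ≠ 0) ∧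
    ∀ W ∈ S, (∃ p, frameMem K p W.1 ∧ eval p G ≠ 0) → P W

/-- A property `P` holds for a general pair of members of the families `S`, `T`. -/
def GenerallyOnGr2 {k N : ℕ} (S T : Set (Grass K k N))
    (P : Grass K k N → Grass K k N → Prop) : Prop :=
  ∃ G : MvPolynomial ((Fin k × Fin (N + 1)) ⊕ (Fin k × Fin (N + 1))) K,
    (∃ W ∈ S, ∃ W' ∈ T, ∃ p q, frameMem K p W.1 ∧ frameMem K q W'.1 ∧
      eval (Sum.elim p q) G ≠ 0) ∧
    ∀ W ∈ S, ∀ W' ∈ T, (∃ p q, frameMem K p W.1 ∧ frameMem K q W'.1 ∧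
      eval (Sum.elim p q) G ≠ 0) → P W W'

/-- A property `P` holds for a general point of the subset `S ⊆ ℙ^N`. -/
def GenerallyOn {N : ℕ} (S : Set (PP K N)) (P : PP K N → Prop) : Prop :=
  ∃ G : MvPolynomial (Fin (N + 1)) K,
    (∃ x ∈ S, ∃ v ∈ x.submodule, eval v G ≠ 0) ∧
    ∀ x ∈ S, (∃ v ∈ x.submodule, eval v G ≠ 0) → P x

/-- A property `P` holds for a general hyperplane (given by a nonzero linear form `L`). -/
def GenerallyOnHyp {N : ℕ} (P : (Fin (N + 1) → K) → Prop) : Prop :=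
  ∃ G : MvPolynomial (Fin (N + 1)) K,
    (∃ L : Fin (N + 1) → K, L ≠ 0 ∧ eval L G ≠ 0) ∧
    ∀ L : Fin (N + 1) → K, L ≠ 0 → eval L G ≠ 0 → P L

/-- Through a general point of `X = {F = 0}` there pass exactly `μ` lines of the family `Lf`. -/
def HasMuOn {N : ℕ} (Lf : Set (Grass K 2 N)) (F : MvPolynomial (Fin (N + 1)) K)
    (μ : ℕ) : Prop :=
  GenerallyOn K (projZeros K F) (fun x => {W | W ∈ Lf ∧ x ∈ projLinear K W.1}.ncard = μ)

/-- Through a general point of `X = {F = 0}` there pass exactly `μ` lines contained in `X`. -/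
def HasMu {N : ℕ} (F : MvPolynomial (Fin (N + 1)) K) (μ : ℕ) : Prop :=
  HasMuOn K (fanoSet K F) F μ

/-- The ideal of the Fano scheme of lines on `{F = 0}`, in Stiefel (frame) coordinates:
it is generated by the coefficients (in `s,t`) of `F(s·v + t·w)`. -/
def fanoIdeal {N : ℕ} (F : MvPolynomial (Fin (N + 1)) K) :
    Ideal (MvPolynomial (Fin 2 × Fin (N + 1)) K) :=
  Ideal.span {g | ∃ d : Fin 2 →₀ ℕ, g = coeff d
    (aeval (fun j : Fin (N + 1) =>
      (X 0 : MvPolynomial (Fin 2) (MvPolynomial (Fin 2 × Fin (N + 1)) K)) * C (X (0, j)) +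
        X 1 * C (X (1, j))) F)}

/-- An ideal is generically reduced: at every minimal prime `p` over `I`, the localization
of `R/I` is reduced, i.e. `I_p = p_p`. -/
def GenericallyReducedIdeal {R : Type} [CommRing R] (I : Ideal R) : Prop :=
  ∀ p ∈ I.minimalPrimes, ∀ x ∈ p, ∃ s, s ∉ p ∧ s * x ∈ I

/-- The Fano scheme of lines on `{F = 0}` is generically reduced. -/
def FanoGenerallyReduced {N : ℕ} (F : MvPolynomial (Fin (N + 1)) K) : Prop :=
  GenericallyReducedIdeal (fanoIdeal K F)

/-- The prime (in frame coordinates) corresponding to a point `r` of the Grassmannian of lines. -/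
def framePrime {N : ℕ} (r : Grass K 2 N) : Ideal (MvPolynomial (Fin 2 × Fin (N + 1)) K) :=
  affVanishing K (frameCone K 2 N {r})

/-- The Fano scheme of lines on `{F = 0}` is reduced at the line `r`. -/
def FanoReducedAt {N : ℕ} (F : MvPolynomial (Fin (N + 1)) K) (r : Grass K 2 N) : Prop :=
  ∀ x ∈ framePrime K r, ∃ s, s ∉ framePrime K r ∧ s * x ∈ fanoIdeal K F

/-- The Fano scheme is reduced at the generic point of the component `Fam`. -/
def ComponentGenerallyReduced {N : ℕ} (F : MvPolynomial (Fin (N + 1)) K)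
    (Fam : Set (Grass K 2 N)) : Prop :=
  ∀ x ∈ affVanishing K (frameCone K 2 N Fam),
    ∃ s, s ∉ affVanishing K (frameCone K 2 N Fam) ∧ s * x ∈ fanoIdeal K F

/-- The gradient vector of `F` at `v`. -/
def gradVec {N : ℕ} (F : MvPolynomial (Fin (N + 1)) K) (v : Fin (N + 1) → K) :
    Fin (N + 1) → K :=
  fun i => eval v (pderiv i F)

/-- The singular locus of the hypersurface `{F = 0}`. -/
def singLocus {N : ℕ} (F : MvPolynomial (Fin (N + 1)) K) : Set (PP K N) :=
  {x | x ∈ projZeros K F ∧ ∀ v ∈ x.submodule, gradVec K F v = 0}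

/-- `x` is a smooth point of the hypersurface `{F = 0}`. -/
def SmoothAt {N : ℕ} (F : MvPolynomial (Fin (N + 1)) K) (x : PP K N) : Prop :=
  x ∈ projZeros K F ∧ x ∉ singLocus K F

/-- The embedded tangent hyperplane to `{F = 0}` at a (smooth) point `x`. -/
def tangentHyp {N : ℕ} (F : MvPolynomial (Fin (N + 1)) K) (x : PP K N) : Set (PP K N) :=
  {y | ∀ v ∈ x.submodule, ∀ w ∈ y.submodule, ∑ i, gradVec K F v i * w i = 0}

/-- The hyperplane of `ℙ^N` with coefficient vector `L`. -/
def hypSet {N : ℕ} (L : Fin (N + 1) → K) : Set (PP K N) :=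
  {x | ∀ v ∈ x.submodule, ∑ i, L i * v i = 0}

/-- A quadric surface in `ℙ⁴`: a two-dimensional intersection of a quadric and a hyperplane. -/
def IsQuadricSurface (Q : Set (PP K 4)) : Prop :=
  ∃ (q : MvPolynomial (Fin 5) K) (W : Submodule K (Fin 5 → K)),
    q.IsHomogeneous 2 ∧ Module.finrank K W = 4 ∧
    Q = projZeros K q ∩ projLinear K W ∧ HasProjDim K Q 2

/-- `X = {F = 0}` is (birationally) ruled by quadrics over a curve: it is covered by a
one-dimensional family of quadric surfaces with exactly one member through a general point. -/
def QuadricBundle (F : MvPolynomial (Fin 5) K) : Prop :=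
  ∃ 𝒬 : Set (Set (PP K 4)),
    (∀ Q ∈ 𝒬, IsQuadricSurface K Q ∧ Q ⊆ projZeros K F) ∧
    GenerallyOn K (projZeros K F) (fun x => ∃! Q, Q ∈ 𝒬 ∧ x ∈ Q)

/-- The degree of a `d`-dimensional subset `S ⊆ ℙ^N`: the largest finite number of points in
which a linear subspace of complementary dimension meets `S`. -/
def projDegree {N : ℕ} (S : Set (PP K N)) (d : ℕ) : ℕ :=
  sSup {m | ∃ W : Submodule K (Fin (N + 1) → K), Module.finrank K W = N + 1 - d ∧
    (S ∩ projLinear K W).Finite ∧ (S ∩ projLinear K W).ncard = m}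

/-- Zariski-closed subsets of `ℙ^N`. -/
def ProjClosed {N : ℕ} (S : Set (PP K N)) : Prop :=
  ∃ 𝒮 : Set (MvPolynomial (Fin (N + 1)) K),
    S = {x | ∀ f ∈ 𝒮, ∀ v ∈ x.submodule, eval v f = 0}

/-- The Zariski closure of a subset of `ℙ^N`. -/
def projClosure {N : ℕ} (S : Set (PP K N)) : Set (PP K N) :=
  ⋂₀ {C | ProjClosed K C ∧ S ⊆ C}

/-- The image of a subset of `ℙ^a` under the rational map `ℙ^a ⤏ ℙ^b` induced by a
linear map `T : K^{a+1} → K^{b+1}`. -/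
def projImage {a b : ℕ} (T : (Fin (a + 1) → K) →ₗ[K] (Fin (b + 1) → K))
    (Y : Set (PP K a)) : Set (PP K b) :=
  {x | ∃ y ∈ Y, ∃ v ∈ y.submodule, ∃ h : T v ≠ 0, x = Projectivization.mk K (T v) h}

/-- `Xs ⊆ ℙ^b` is a (linear) projection of `Y ⊆ ℙ^a`. -/
def IsProjectionOf {a b : ℕ} (Xs : Set (PP K b)) (Y : Set (PP K a)) : Prop :=
  ∃ T : (Fin (a + 1) → K) →ₗ[K] (Fin (b + 1) → K),
    Xs = projClosure K (projImage K T Y)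

/-- `Y ⊆ ℙ⁵` is a three-dimensional complete intersection of two quadric hypersurfaces. -/
def IsQuadricIntersection5 (Y : Set (PP K 5)) : Prop :=
  ∃ q₁ q₂ : MvPolynomial (Fin 6) K, q₁.IsHomogeneous 2 ∧ q₂.IsHomogeneous 2 ∧
    Y = projZeros K q₁ ∩ projZeros K q₂ ∧ HasProjDim K Y 3

def idx55 : Fin 25 ≃ Fin 5 × Fin 5 :=
  (finCongr (by norm_num : 25 = 5 * 5)).trans finProdFinEquiv.symm

/-- The Plücker coordinate vector of the pair `(v, w)`. -/
def pluckOf (v w : Fin 5 → K) : Fin 25 → K :=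
  fun kk => v (idx55 kk).1 * w (idx55 kk).2 - v (idx55 kk).2 * w (idx55 kk).1

/-- The Grassmannian `G(1,4)` of lines of `ℙ⁴` in its Plücker embedding. -/
def grassPlucker : Set (PP K 24) :=
  {x | ∃ v w : Fin 5 → K, ∃ h : pluckOf K v w ≠ 0,
    x = Projectivization.mk K (pluckOf K v w) h}

/-- `Y` is a section of the Plücker-embedded `G(1,4)` by a linear `ℙ⁶`. -/
def IsGrassP6Section (Y : Set (PP K 24)) : Prop :=
  ∃ W : Submodule K (Fin 25 → K), Module.finrank K W = 7 ∧
    Y = grassPlucker K ∩ projLinear K W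

def idx33 : Fin 9 ≃ Fin 3 × Fin 3 :=
  (finCongr (by norm_num : 9 = 3 * 3)).trans finProdFinEquiv.symm

def segre22Vec (a b : Fin 3 → K) : Fin 9 → K := fun kk => a (idx33 kk).1 * b (idx33 kk).2

/-- The Segre embedding of `ℙ² × ℙ²` in `ℙ⁸`. -/
def segreP2P2 : Set (PP K 8) :=
  {x | ∃ a b : Fin 3 → K, ∃ h : segre22Vec K a b ≠ 0,
    x = Projectivization.mk K (segre22Vec K a b) h}

def idx222 : Fin 8 ≃ Fin 2 × Fin 2 × Fin 2 :=
  (finCongr (by norm_num : 8 = 2 * 4)).trans (finProdFinEquiv.symm.trans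
    (Equiv.prodCongr (Equiv.refl _)
      ((finCongr (by norm_num : 4 = 2 * 2)).trans finProdFinEquiv.symm)))

def segre111Vec (a b c : Fin 2 → K) : Fin 8 → K :=
  fun kk => a (idx222 kk).1 * b (idx222 kk).2.1 * c (idx222 kk).2.2

/-- The Segre embedding of `ℙ¹ × ℙ¹ × ℙ¹` in `ℙ⁷`. -/
def segreP1P1P1 : Set (PP K 7) :=
  {x | ∃ a b c : Fin 2 → K, ∃ h : segre111Vec K a b c ≠ 0,
    x = Projectivization.mk K (segre111Vec K a b c) h}

def evalVec {m l : ℕ} (f : Fin l → MvPolynomial (Fin m) K) (v : Fin m → K) : Fin l → K :=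
  fun j => eval v (f j)

/-- Two projective sets are birational: there are rational maps, given by homogeneous
polynomials, defined and mutually inverse on general points. -/
def AreBirational {a b : ℕ} (C : Set (PP K a)) (D : Set (PP K b)) : Prop :=
  ∃ (f : Fin (b + 1) → MvPolynomial (Fin (a + 1)) K)
    (g : Fin (a + 1) → MvPolynomial (Fin (b + 1)) K) (d e : ℕ),
    (∀ j, (f j).IsHomogeneous d) ∧ (∀ i, (g i).IsHomogeneous e) ∧
    GenerallyOn K C (fun x => ∃ v ∈ x.submodule, ∃ h : evalVec K f v ≠ 0,
      Projectivization.mk K (evalVec K f v) h ∈ D ∧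
      ∃ h2 : evalVec K g (evalVec K f v) ≠ 0,
        Projectivization.mk K (evalVec K g (evalVec K f v)) h2 = x) ∧
    GenerallyOn K D (fun y => ∃ w ∈ y.submodule, ∃ h : evalVec K g w ≠ 0,
      Projectivization.mk K (evalVec K g w) h ∈ C ∧
      ∃ h2 : evalVec K f (evalVec K g w) ≠ 0,
        Projectivization.mk K (evalVec K f (evalVec K g w)) h2 = y)

/-- A smooth plane cubic curve (its equation). -/
def IsSmoothPlaneCubic (q : MvPolynomial (Fin 3) K) : Prop :=
  q.IsHomogeneous 3 ∧
    ∀ v : Fin 3 → K, v ≠ 0 → eval v q = 0 → (fun i => eval v (pderiv i q)) ≠ 0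

/-- The hypersurface `{F = 0} ⊆ ℙ⁴` has sectional genus one: its general plane section is a
curve birational to a smooth plane cubic (i.e. of geometric genus `1`). -/
def SectionalGenusOne (F : MvPolynomial (Fin 5) K) : Prop :=
  GenerallyOnGr K (Set.univ : Set (Grass K 3 4)) (fun P =>
    ∃ q : MvPolynomial (Fin 3) K, IsSmoothPlaneCubic K q ∧
      AreBirational K (projZeros K F ∩ projLinear K P.1) (projZeros (N := 2) K q))

/-- The length of a module, as the Krull dimension of its lattice of submodules. -/
def moduleLength (R M : Type) [CommRing R] [AddCommGroup M] [Module R M] : WithBot ℕ∞ :=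
  Order.krullDim (Submodule R M)

/-- The length of the localization of `R/I` at (the complement of) `p`:  when `p` is a prime
containing `I` this is the intersection multiplicity of the scheme `V(I)` at `p`. -/
def localLength {R : Type} [CommRing R] (I p : Ideal R) : WithBot ℕ∞ :=
  moduleLength (Localization (Submonoid.closure {s : R | s ∉ p}))
    (LocalizedModule (Submonoid.closure {s : R | s ∉ p}) (R ⧸ I))

/-- The frame-coordinate ideal of the Schubert variety of lines contained in the hyperplane
with coefficient vector `L`. -/
def hypFrameIdeal (L : Fin 5 → K) : Ideal (MvPolynomial (Fin 2 × Fin 5) K) :=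
  Ideal.span {∑ j, C (L j) * X ((0 : Fin 2), j), ∑ j, C (L j) * X ((1 : Fin 2), j)}

/-- The restriction of a polynomial to the line spanned by `v` and `w`, as a binary form in
the parameters. -/
def restrictLine {N : ℕ} (v w : Fin (N + 1) → K) (G : MvPolynomial (Fin (N + 1)) K) :
    MvPolynomial (Fin 2) K :=
  aeval (fun j => C (v j) * X 0 + C (w j) * X 1) G

/-- The homogeneous polynomials vanishing on a subset `S ⊆ ℙ^N`. -/
def homVanishing {N : ℕ} (S : Set (PP K N)) : Set (MvPolynomial (Fin (N + 1)) K) :=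
  {f | ∀ x ∈ S, ∀ v ∈ x.submodule, eval v f = 0}

/-- The embedded (projectivized) tangent space to the subset `S ⊆ ℙ^N` at the point `P`. -/
def projTangentAt {N : ℕ} (S : Set (PP K N)) (P : PP K N) : Set (PP K N) :=
  {y | ∀ f ∈ homVanishing K S, ∀ v ∈ P.submodule, ∀ w ∈ y.submodule,
    ∑ i, eval v (pderiv i f) * w i = 0}

/-- `P` is a smooth point of the surface `S`: its embedded tangent space is a plane. -/
def IsSmoothSurfacePoint {N : ℕ} (S : Set (PP K N)) (P : PP K N) : Prop :=
  P ∈ S ∧ ∃ W : Submodule K (Fin (N + 1) → K), Module.finrank K W = 3 ∧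
    projTangentAt K S P = projLinear K W

/-- The line `L` is tangent to the surface `S` at the smooth point `P`. -/
def IsTangentLineAt {N : ℕ} (S : Set (PP K N)) (L : Grass K 2 N) (P : PP K N) : Prop :=
  IsSmoothSurfacePoint K S P ∧ P ∈ projLinear K L.1 ∧
    projLinear K L.1 ⊆ projTangentAt K S P

/-- The surface `σ(r)`: the union of the lines of the Fano family meeting the line `r`. -/
def sigmaSurf (F : MvPolynomial (Fin 5) K) (r : Grass K 2 4) : Set (PP K 4) :=
  {x | ∃ W ∈ fanoSet K F, (projLinear K W.1 ∩ projLinear K r.1).Nonempty ∧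
    x ∈ projLinear K W.1}

/-- Substitution of a linear endomorphism into a polynomial: `linSubst φ P = P ∘ φ`. -/
def linSubst {m : ℕ} (φ : (Fin m → K) →ₗ[K] (Fin m → K)) (P : MvPolynomial (Fin m) K) :
    MvPolynomial (Fin m) K :=
  aeval (fun i => ∑ j, C (φ (Pi.single j 1) i) * X j) P

/-- Dehomogenization with respect to the coordinate `x₀`. -/
def dehomAt0 {m : ℕ} (P : MvPolynomial (Fin (m + 1)) K) : MvPolynomial (Fin m) K :=
  aeval (fun i : Fin (m + 1) => Fin.cases 1 (fun j => X j) i) P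

/-- The Gauss image (dual variety, up to closure) of the hypersurface `{F = 0} ⊆ ℙ^N`. -/
def dualVariety {N : ℕ} (F : MvPolynomial (Fin (N + 1)) K) : Set (PP K N) :=
  {h | ∃ x, SmoothAt K F x ∧ ∃ v ∈ x.submodule, ∃ hnz : gradVec K F v ≠ 0,
    h = Projectivization.mk K (gradVec K F v) hnz}

/-- In characteristic zero, every field extension is formally smooth. -/
theorem formallySmooth_of_charZero (k Ω : Type) [Field k] [Field Ω] [CharZero k] [Algebra k Ω] :
    Algebra.FormallySmooth k Ω := by
  obtain ⟨s, hs⟩ := exists_isTranscendenceBasis' k Ω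
  obtain ⟨x, hx⟩ := hs
  have halg := hx.isAlgebraic_field
  have : Algebra.IsSeparable (IntermediateField.adjoin k (Set.range x)) Ω := inferInstance
  exact Algebra.FormallySmooth.of_algebraicIndependent_of_isSeparable hx.1

/-- Ring homomorphisms to a nilpotent thickening of a field extend along field extensions. -/
theorem exists_ringHom_extend {k Ω B : Type} [Field k] [Field Ω] [CharZero k] [Algebra k Ω]
    [CommRing B] (h : k →+* B) (g : B →+* Ω) (hg : Function.Surjective g)
    (hn : IsNilpotent (RingHom.ker g)) (hgh : g.comp h = algebraMap k Ω) :
    ∃ H : Ω →+* B, g.comp H = RingHom.id Ω ∧ H.comp (algebraMap k Ω) = h := by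
  let := h.toAlgebra
  have := formallySmooth_of_charZero k Ω
  let g' : B →ₐ[k] Ω := { g with commutes' := fun r => RingHom.congr_fun hgh r }
  have hn' : IsNilpotent (RingHom.ker (g' : B →+* Ω)) := hn
  refine ⟨(Algebra.FormallySmooth.liftOfSurjective (AlgHom.id k Ω) g' hg hn').toRingHom, ?_, ?_⟩
  · ext x
    exact Algebra.FormallySmooth.liftOfSurjective_apply (AlgHom.id k Ω) g' hg hn' x
  · ext x
    exact (Algebra.FormallySmooth.liftOfSurjective (AlgHom.id k Ω) g' hg hn').commutes x

section tangent

variable {K Ω σ : Type} [Field K] [CommRing Ω] [Algebra K Ω] [Fintype σ]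

/-- The derivative of a polynomial at the point `p` in the direction `p'`. -/
def dirDeriv (p p' : σ → Ω) : MvPolynomial σ K →ₗ[K] Ω where
  toFun f := ∑ j, aeval p (pderiv j f) * p' j
  map_add' f g := by simp [add_mul, Finset.sum_add_distrib]
  map_smul' c f := by simp [Finset.mul_sum, Algebra.smul_def, mul_assoc]

theorem dirDeriv_apply (p p' : σ → Ω) (f : MvPolynomial σ K) :
    dirDeriv p p' f = ∑ j, aeval p (pderiv j f) * p' j := rfl

theorem dirDeriv_mul (p p' : σ → Ω) (f g : MvPolynomial σ K) :
    dirDeriv p p' (f * g) = aeval p f * dirDeriv p p' g + aeval p g * dirDeriv p p' f := by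
  simp only [dirDeriv_apply, Finset.mul_sum, ← Finset.sum_add_distrib]
  refine Finset.sum_congr rfl fun j _ => ?_
  simp only [Derivation.leibniz, smul_eq_mul, map_add, map_mul]
  ring

@[simp] theorem dirDeriv_C (p p' : σ → Ω) (c : K) : dirDeriv p p' (C c) = 0 := by
  simp [dirDeriv_apply]

@[simp] theorem dirDeriv_X (p p' : σ → Ω) (i : σ) :
    dirDeriv p p' (X i : MvPolynomial σ K) = p' i := by
  classical
  simp [dirDeriv_apply, pderiv_X, Pi.single_apply]

/-- The Zariski tangent space at a point `p` of its closure. -/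
def tangentSpace (K : Type) [Field K] [Algebra K Ω] (p : σ → Ω) : Submodule Ω (σ → Ω) where
  carrier := {p' | ∀ f : MvPolynomial σ K, aeval p f = 0 → dirDeriv p p' f = 0}
  add_mem' {a b} ha hb f hf := by
    have h1 := ha f hf
    have h2 := hb f hf
    simp only [dirDeriv_apply] at *
    simp [mul_add, Finset.sum_add_distrib, h1, h2]
  zero_mem' f _ := by simp [dirDeriv_apply]
  smul_mem' c a ha f hf := by
    have h1 := ha f hf
    simp only [dirDeriv_apply] at *
    simp [mul_left_comm, ← Finset.mul_sum, h1]

theorem mem_tangentSpace {p p' : σ → Ω} : p' ∈ tangentSpace K p ↔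
    ∀ f : MvPolynomial σ K, aeval p f = 0 → dirDeriv p p' f = 0 := Iff.rfl

/-- A derivation computes directional derivatives. -/
theorem derivation_aeval (D : Derivation K Ω Ω) (p : σ → Ω) (f : MvPolynomial σ K) :
    D (aeval p f) = dirDeriv p (fun j => D (p j)) f := by
  induction f using MvPolynomial.induction_on with
  | C a => simp
  | add f g hf hg => simp [hf, hg]
  | mul_X f i hf =>
    rw [dirDeriv_mul, map_mul, Derivation.leibniz, hf]
    simp

theorem derivation_mem_tangentSpace (D : Derivation K Ω Ω) (p : σ → Ω) :
    (fun j => D (p j)) ∈ tangentSpace K p := fun f hf => by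
  rw [← derivation_aeval, hf, map_zero]

/-- The chain rule for directional derivatives. -/
theorem dirDeriv_aeval {τ : Type} [Fintype τ] (p p' : σ → Ω) (θ : τ → MvPolynomial σ K)
    (f : MvPolynomial τ K) :
    dirDeriv p p' (aeval θ f) =
      dirDeriv (fun i => aeval p (θ i)) (fun i => dirDeriv p p' (θ i)) f := by
  have hcomp : ∀ g : MvPolynomial τ K, aeval p (aeval θ g) = aeval (fun i => aeval p (θ i)) g :=
    fun g => by
      have : (aeval p).comp (aeval θ) =
          (aeval (fun i => aeval p (θ i)) : MvPolynomial τ K →ₐ[K] Ω) := by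
        ext i; simp
      exact DFunLike.congr_fun this g
  induction f using MvPolynomial.induction_on with
  | C a => simp [MvPolynomial.algebraMap_eq]
  | add f g hf hg => simp only [map_add, hf, hg]
  | mul_X f i hf =>
    rw [dirDeriv_mul, map_mul, dirDeriv_mul, hf, hcomp]
    simp

end tangent

section tangentField

variable {K Ω σ : Type} [Field K] [Field Ω] [Algebra K Ω] [Fintype σ]

open TrivSqZeroExt in
/-- In characteristic zero every tangent vector comes from a derivation of the field. -/
theorem exists_derivation [CharZero K] {p p' : σ → Ω} (hp : p' ∈ tangentSpace K p) :
    ∃ D : Derivation K Ω Ω, ∀ j, D (p j) = p' j := by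
  let φ : MvPolynomial σ K →ₐ[K] Ω := aeval p
  let I : Ideal (MvPolynomial σ K) := RingHom.ker φ.toRingHom
  have : I.IsPrime := RingHom.ker_isPrime _
  let A := MvPolynomial σ K ⧸ I
  let h₀ : MvPolynomial σ K →+* DualNumber Ω :=
    { toFun := fun f => (inl (aeval p f) + inr (dirDeriv p p' f))
      map_one' := by
        have := dirDeriv_C (K := K) p p' 1
        rw [C_1] at this
        ext <;> simp [this]
      map_mul' := fun f g => by
        ext
        · simp
        · simp [dirDeriv_mul]; ring
      map_zero' := by ext <;> simp
      map_add' := fun f g => by ext <;> simp }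
  let h₁ : A →+* DualNumber Ω := Ideal.Quotient.lift I h₀ (fun a ha => by
    have h1 : aeval p a = 0 := ha
    have h2 := hp a h1
    show inl (aeval p a) + inr (dirDeriv p p' a) = _
    rw [h1, h2]; ext <;> simp)
  let ψ : A →+* Ω := RingHom.kerLift φ.toRingHom
  have hψ : Function.Injective ψ := RingHom.kerLift_injective _
  have hψ₁ : ∀ a, (h₁ a).fst = ψ a := by
    intro a
    obtain ⟨f, rfl⟩ := Ideal.Quotient.mk_surjective a
    show (inl (aeval p f) + inr (dirDeriv p p' f) : DualNumber Ω).fst = aeval p f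
    simp
  let k := FractionRing A
  let : Algebra k Ω := (IsFractionRing.lift hψ : k →+* Ω).toAlgebra
  have hk : ∀ a, algebraMap k Ω (algebraMap A k a) = ψ a := fun a =>
    IsFractionRing.lift_algebraMap hψ a
  have : CharZero k := by
    have : Function.Injective ((algebraMap A k).comp (algebraMap K A)) := RingHom.injective _
    exact charZero_of_injective_ringHom this
  let h : k →+* DualNumber Ω := IsLocalization.lift (M := nonZeroDivisors A) (g := h₁) (by
    rintro ⟨y, hy⟩
    rw [TrivSqZeroExt.isUnit_iff_isUnit_fst, hψ₁]
    exact (((map_ne_zero_iff ψ hψ).2 (nonZeroDivisors.ne_zero hy))).isUnit)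
  have hh : ∀ a, h (algebraMap A k a) = h₁ a := fun a => IsLocalization.lift_eq _ a
  let g : DualNumber Ω →+* Ω := (fstHom Ω Ω Ω).toRingHom
  have hg : Function.Surjective g := fun x => ⟨inl x, rfl⟩
  have hn : IsNilpotent (RingHom.ker g) := by
    refine ⟨2, ?_⟩
    refine le_bot_iff.mp ((pow_two (RingHom.ker g)).le.trans (Ideal.mul_le.mpr ?_))
    intro r hr s hs
    have h1 : r.fst = 0 := hr
    have h2 : s.fst = 0 := hs
    rw [Ideal.mem_bot]
    ext <;> simp [h1, h2]
  have hgh : g.comp h = algebraMap k Ω := by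
    apply IsLocalization.ringHom_ext (nonZeroDivisors A)
    refine RingHom.ext fun a => ?_
    simp only [RingHom.comp_apply]
    rw [hh, hk]
    exact hψ₁ a
  obtain ⟨H, hH1, hH2⟩ := exists_ringHom_extend h g hg hn hgh
  have hfst : ∀ x, (H x).fst = x := fun x => RingHom.congr_fun hH1 x
  have hpol : ∀ f : MvPolynomial σ K, H (aeval p f) = inl (aeval p f) + inr (dirDeriv p p' f) := by
    intro f
    have e1 : aeval p f = algebraMap k Ω (algebraMap A k (Ideal.Quotient.mk I f)) := by
      rw [hk]; rfl
    have e2 : H (algebraMap k Ω (algebraMap A k (Ideal.Quotient.mk I f))) =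
        h (algebraMap A k (Ideal.Quotient.mk I f)) := RingHom.congr_fun hH2 _
    rw [e1, e2, hh, ← e1]
    rfl
  have hsmul : ∀ c : K, (H (algebraMap K Ω c)).snd = 0 := by
    intro c
    have := hpol (C c)
    rw [dirDeriv_C] at this
    rw [show algebraMap K Ω c = aeval p (C c) by simp, this]
    simp
  refine ⟨Derivation.mk'
    { toFun := fun x => (H x).snd
      map_add' := fun x y => by simp
      map_smul' := fun c x => by
        simp [Algebra.smul_def, hsmul, hfst] } (fun a b => by simp [hfst, mul_comm]), fun j => ?_⟩
  show (H (p j)).snd = p' j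
  have := hpol (X j)
  simp only [aeval_X, dirDeriv_X] at this
  rw [this]; simp

end tangentField

/-- The Krull dimension does not drop along injective integral extensions. -/
theorem ringKrullDim_le_of_isIntegral {R S : Type} [CommRing R] [CommRing S] (f : R →+* S)
    (hf : Function.Injective f) (hfi : f.IsIntegral) : ringKrullDim R ≤ ringKrullDim S := by
  let := f.toAlgebra
  have hI : Algebra.IsIntegral R S := ⟨hfi⟩
  refine iSup_le fun l => ?_
  obtain ⟨Q, -, hQ, hQ'⟩ := Ideal.exists_ideal_over_prime_of_isIntegral
    (RelSeries.head l).asIdeal (⊥ : Ideal S) (by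
      rw [← RingHom.ker_eq_comap_bot, (RingHom.injective_iff_ker_eq_bot (algebraMap R S)).1 hf]
      exact bot_le)
  have : Q.LiesOver (RelSeries.head l).asIdeal := ⟨hQ'.symm⟩
  obtain ⟨L, hL, -⟩ := Ideal.exists_ltSeries_of_hasGoingUp (S := S) l Q
  rw [← hL]
  exact Order.LTSeries.length_le_krullDim L

section dimension

variable {K Ω σ : Type} [Field K] [Field Ω] [Algebra K Ω]

/-- The constants of a derivation of a field. -/
def constantField (D : Derivation K Ω Ω) : IntermediateField K Ω where
  carrier := {x | D x = 0}
  mul_mem' {a b} ha hb := by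
    have ha : D a = 0 := ha
    have hb : D b = 0 := hb
    simp [ha, hb]
  add_mem' {a b} ha hb := by
    have ha : D a = 0 := ha
    have hb : D b = 0 := hb
    simp [ha, hb]
  algebraMap_mem' r := by simp
  inv_mem' x hx := by
    have hx : D x = 0 := hx
    simp [Derivation.leibniz_inv, hx]

theorem mem_constantField {D : Derivation K Ω Ω} {x : Ω} : x ∈ constantField D ↔ D x = 0 :=
  Iff.rfl

/-- In characteristic zero the constants of a derivation are algebraically closed. -/
theorem mem_constantField_of_isIntegral [CharZero K] (D : Derivation K Ω Ω) {x : Ω}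
    (hx : IsIntegral (constantField D) x) : D x = 0 := by
  let D' : Derivation (constantField D) Ω Ω := Derivation.mk'
    { toFun := D
      map_add' := map_add D
      map_smul' := fun c y => by
        have : D (c : Ω) = 0 := c.2
        simp [Algebra.smul_def, this] } (fun a b => D.leibniz a b)
  have h1 := Derivation.map_aeval D' (minpoly (constantField D) x) x
  rw [minpoly.aeval, map_zero] at h1
  have h2 := (minpoly.irreducible hx).separable.aeval_derivative_ne_zero (minpoly.aeval _ x)
  exact (smul_eq_zero.1 h1.symm).resolve_left h2

variable [Fintype σ]

/-- In characteristic zero, the tangent space at a generic point has dimension at most the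
dimension of the variety. -/
theorem finrank_tangentSpace_le [CharZero K] (p : σ → Ω) :
    ((Module.finrank Ω (tangentSpace K p) : ℕ) : WithBot ℕ∞) ≤
      ringKrullDim (MvPolynomial σ K ⧸ RingHom.ker (aeval p : MvPolynomial σ K →ₐ[K] Ω)) := by
  let I : Ideal (MvPolynomial σ K) := RingHom.ker (aeval p : MvPolynomial σ K →ₐ[K] Ω)
  have hI : I.IsPrime := RingHom.ker_isPrime _
  let A := MvPolynomial σ K ⧸ I
  have : Nontrivial A := Ideal.Quotient.nontrivial_iff.2 hI.ne_top
  obtain ⟨d, g, hg, hgi⟩ := exists_integral_inj_algHom_of_fg K A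
  have hdim : ((d : ℕ) : WithBot ℕ∞) ≤ ringKrullDim A := by
    have := ringKrullDim_le_of_isIntegral g.toRingHom hg hgi
    rw [MvPolynomial.ringKrullDim_of_isNoetherianRing, ringKrullDim_eq_zero_of_field] at this
    simpa using this
  refine le_trans ?_ hdim
  choose y hy using fun i : Fin d => Ideal.Quotient.mk_surjective (g (X i))
  let L : tangentSpace K p →ₗ[Ω] (Fin d → Ω) :=
    { toFun := fun p' i => dirDeriv p p'.1 (y i)
      map_add' := fun a b => by
        ext i
        simp [dirDeriv_apply, mul_add, Finset.sum_add_distrib]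
      map_smul' := fun c a => by
        ext i
        simp [dirDeriv_apply, Finset.mul_sum, mul_left_comm] }
  have hL : Function.Injective L := by
    rw [← LinearMap.ker_eq_bot, LinearMap.ker_eq_bot']
    rintro ⟨p', hp'⟩ h0
    obtain ⟨D, hD⟩ := exists_derivation hp'
    have hDy : ∀ i, D (aeval p (y i)) = 0 := fun i => by
      rw [derivation_aeval, funext hD]
      exact congrFun h0 i
    let φ : A →ₐ[K] Ω := Ideal.Quotient.liftₐ I (aeval p) (fun a ha => ha)
    have hφ : ∀ f, φ (Ideal.Quotient.mk I f) = aeval p f := fun f => rfl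
    have hrange : ∀ f, φ (g f) ∈ constantField D := by
      intro f
      have : φ.comp g = aeval (fun i => aeval p (y i)) := by
        ext i
        simp [← hy, hφ]
      have h2 : φ (g f) = aeval (fun i => aeval p (y i)) f := DFunLike.congr_fun this f
      rw [h2]
      have : aeval (fun i => aeval p (y i)) f =
          ((aeval (fun i => (⟨aeval p (y i), hDy i⟩ : constantField D)) f :
            constantField D) : Ω) := by
        have := MvPolynomial.map_aeval (fun i => (⟨aeval p (y i), hDy i⟩ : constantField D))
          (algebraMap (constantField D) Ω) f
        rw [show ((aeval (fun i => (⟨aeval p (y i), hDy i⟩ : constantField D)) f :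
            constantField D) : Ω) = algebraMap (constantField D) Ω (aeval _ f) from rfl, this,
          ← IsScalarTower.algebraMap_eq]
        rfl
      rw [this]
      exact Subtype.property _
    ext j
    show p' j = 0
    rw [← hD j]
    apply mem_constantField_of_isIntegral
    obtain ⟨m, hm, hm0⟩ := hgi (Ideal.Quotient.mk I (X j))
    let γ : MvPolynomial (Fin d) K →+* constantField D :=
      (φ.toRingHom.comp g.toRingHom).codRestrict (constantField D).toSubfield hrange
    refine ⟨m.map γ, hm.map γ, ?_⟩
    rw [Polynomial.eval₂_map]
    have h3 := congrArg φ hm0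
    rw [map_zero] at h3
    have h4 := Polynomial.hom_eval₂ m g.toRingHom φ.toRingHom (Ideal.Quotient.mk I (X j))
    have h5 : φ.toRingHom (Ideal.Quotient.mk I (X j)) = p j := by
      show φ (Ideal.Quotient.mk I (X j)) = p j
      rw [hφ, aeval_X]
    rw [h5] at h4
    rw [show (algebraMap (constantField D) Ω).comp γ = φ.toRingHom.comp g.toRingHom from rfl,
      ← h4]
    exact h3
  have := LinearMap.finrank_le_finrank_of_injective hL
  rw [Module.finrank_fin_fun] at this
  exact_mod_cast this

end dimension

section genericallyReduced

variable {K Ω σ : Type} [Field K] [Field Ω] [Algebra K Ω] [Fintype σ]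

/-- The dimension drops strictly along a strict inclusion of primes. -/
theorem ringKrullDim_quotient_add_one_le {R : Type} [CommRing R] {q P : Ideal R} [q.IsPrime]
    (h : q < P) : ringKrullDim (R ⧸ P) + 1 ≤ ringKrullDim (R ⧸ q) := by
  obtain ⟨x, hxP, hxq⟩ := SetLike.exists_of_lt h
  refine ringKrullDim_succ_le_of_surjective (Ideal.Quotient.factor h.le)
    (Ideal.Quotient.factor_surjective h.le) (r := Ideal.Quotient.mk q x) ?_ ?_
  · rw [mem_nonZeroDivisors_iff_ne_zero]
    exact fun h0 => hxq (Ideal.Quotient.eq_zero_iff_mem.1 h0)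
  · rw [Ideal.Quotient.factor_mk]
    exact Ideal.Quotient.eq_zero_iff_mem.2 hxP

/-- At a generic point of a component of a generically reduced scheme, the equations of the
scheme cut out the tangent space. -/
theorem mem_tangentSpace_of_genericallyReduced [CharZero K] {I : Ideal (MvPolynomial σ K)}
    (hred : ∀ P ∈ I.minimalPrimes, ∀ x ∈ P, ∃ s, s ∉ P ∧ s * x ∈ I) {N : ℕ}
    (hdim : ∀ P : Ideal (MvPolynomial σ K), P.IsPrime → I ≤ P →
      ringKrullDim (MvPolynomial σ K ⧸ P) ≤ (N : WithBot ℕ∞))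
    {p p' : σ → Ω} (hp : ∀ f ∈ I, aeval p f = 0)
    (hN : N ≤ Module.finrank Ω (tangentSpace K p))
    (hp' : ∀ f ∈ I, dirDeriv p p' f = 0) : p' ∈ tangentSpace K p := by
  let P : Ideal (MvPolynomial σ K) := RingHom.ker (aeval p : MvPolynomial σ K →ₐ[K] Ω)
  have hP : P.IsPrime := RingHom.ker_isPrime _
  obtain ⟨q, hq, hqP⟩ := Ideal.exists_minimalPrimes_le (J := P) hp
  have hqprime : q.IsPrime := hq.1.1
  have hqP' : q = P := by
    by_contra hne
    have h1 := ringKrullDim_quotient_add_one_le (lt_of_le_of_ne hqP hne)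
    have h2 := hdim q hqprime hq.1.2
    have h3 := finrank_tangentSpace_le (K := K) p
    have h4 : ((N : ℕ) : WithBot ℕ∞) ≤ (Module.finrank Ω (tangentSpace K p) : ℕ) := by
      exact_mod_cast hN
    have h5 : ((N : ℕ) : WithBot ℕ∞) + 1 ≤ (N : ℕ) :=
      ((add_le_add_left (h4.trans h3) 1).trans h1).trans h2
    have h6 : N + 1 ≤ N := by exact_mod_cast h5
    omega
  subst hqP'
  intro f hf
  obtain ⟨s, hs, hsf⟩ := hred P hq f hf
  have h := hp' _ hsf
  rw [dirDeriv_mul, hf, zero_mul, add_zero] at h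
  exact (mul_eq_zero.1 h).resolve_left hs

end genericallyReduced

section fano

variable {K Ω : Type} [Field K]

/-- The form `F(s v + t w)` in the frame coordinates `(v, w)`. -/
def lineEval (F : MvPolynomial (Fin 5) K) (s t : K) : MvPolynomial (Fin 2 × Fin 5) K :=
  aeval (fun j => C s * X (0, j) + C t * X (1, j)) F

/-- The form `F(s v + t w)` as a polynomial in `s, t` over the frame coordinates. -/
def linePoly (F : MvPolynomial (Fin 5) K) :
    MvPolynomial (Fin 2) (MvPolynomial (Fin 2 × Fin 5) K) :=
  aeval (fun j : Fin (4 + 1) =>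
      (X 0 : MvPolynomial (Fin 2) (MvPolynomial (Fin 2 × Fin (4 + 1)) K)) * C (X (0, j)) +
        X 1 * C (X (1, j))) F

theorem fanoIdeal_eq (F : MvPolynomial (Fin 5) K) :
    fanoIdeal K F = Ideal.span {g | ∃ d : Fin 2 →₀ ℕ, g = coeff d (linePoly F)} := rfl

theorem lineEval_eq (F : MvPolynomial (Fin 5) K) (s t : K) :
    lineEval F s t = eval ![C s, C t] (linePoly F) := by
  unfold lineEval linePoly
  induction F using MvPolynomial.induction_on with
  | C a =>
    rw [aeval_C, aeval_C]
    simp [MvPolynomial.algebraMap_apply]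
  | add f g hf hg => simp only [map_add, hf, hg]
  | mul_X f i hf =>
    rw [map_mul, map_mul, map_mul, hf, aeval_X, aeval_X]
    simp

theorem lineEval_eq_sum (F : MvPolynomial (Fin 5) K) (s t : K) :
    lineEval F s t = ∑ d ∈ (linePoly F).support, (s ^ d 0 * t ^ d 1) • coeff d (linePoly F) := by
  rw [lineEval_eq, eval_eq']
  refine Finset.sum_congr rfl fun d _ => ?_
  simp [smul_eq_C_mul, Fin.prod_univ_two, mul_comm]

theorem lineEval_mem_fanoIdeal (F : MvPolynomial (Fin 5) K) (s t : K) :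
    lineEval F s t ∈ fanoIdeal K F := by
  rw [lineEval_eq_sum, fanoIdeal_eq]
  refine Ideal.sum_mem _ fun d _ => ?_
  rw [smul_eq_C_mul]
  exact Ideal.mul_mem_left _ _ (Ideal.subset_span ⟨d, rfl⟩)

variable [Field Ω] [Algebra K Ω]

/-- A polynomial with coefficients in an extension of an infinite field vanishing at all points
with coordinates in the small field is zero. -/
theorem eq_zero_of_eval_algebraMap [Infinite K] {σ : Type} [Finite σ] (f : MvPolynomial σ Ω)
    (h : ∀ x : σ → K, eval (fun i => algebraMap K Ω (x i)) f = 0) : f = 0 := by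
  refine funext_set (fun _ => Set.range (algebraMap K Ω))
    (fun _ => Set.infinite_range_of_injective (algebraMap K Ω).injective) fun x hx => ?_
  have h1 : ∀ i, ∃ y, algebraMap K Ω y = x i := fun i => hx i (Set.mem_univ i)
  choose y hy using h1
  rw [← funext hy, h, map_zero]

theorem map_coeff_linePoly_eq_zero [Infinite K] (F : MvPolynomial (Fin 5) K)
    (l : MvPolynomial (Fin 2 × Fin 5) K →ₗ[K] Ω) (h : ∀ s t, l (lineEval F s t) = 0)
    (d : Fin 2 →₀ ℕ) : l (coeff d (linePoly F)) = 0 := by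
  classical
  let Q : MvPolynomial (Fin 2) Ω :=
    ∑ d ∈ (linePoly F).support, monomial d (l (coeff d (linePoly F)))
  have hQ : Q = 0 := by
    refine eq_zero_of_eval_algebraMap (K := K) Q fun x => ?_
    have h1 := h (x 0) (x 1)
    rw [lineEval_eq_sum, map_sum] at h1
    rw [map_sum, ← h1]
    refine Finset.sum_congr rfl fun d _ => ?_
    rw [eval_monomial, map_smul, Finsupp.prod_fintype _ _ (by simp), Fin.prod_univ_two,
      Algebra.smul_def]
    simp [mul_comm]
  by_cases hd : d ∈ (linePoly F).support
  · have h2 := congrArg (coeff d) hQ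
    simpa [Q, coeff_sum, coeff_monomial, hd] using h2
  · rw [notMem_support_iff.1 hd, map_zero]

/-- A point lies on the Fano scheme, and a vector is tangent to it, as soon as this holds for
all `K`-rational combinations of the two vectors of the frame. -/
theorem forall_mem_fanoIdeal [Infinite K] (F : MvPolynomial (Fin 5) K)
    (p p' : Fin 2 × Fin 5 → Ω) (h : ∀ s t, aeval p (lineEval F s t) = 0)
    (h' : ∀ s t, dirDeriv p p' (lineEval F s t) = 0) :
    ∀ f ∈ fanoIdeal K F, aeval p f = 0 ∧ dirDeriv p p' f = 0 := by
  intro f hf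
  rw [fanoIdeal_eq] at hf
  induction hf using Submodule.span_induction with
  | mem x hx =>
    obtain ⟨d, rfl⟩ := hx
    exact ⟨map_coeff_linePoly_eq_zero F (aeval p).toLinearMap h d,
      map_coeff_linePoly_eq_zero F (dirDeriv p p') h' d⟩
  | zero => simp
  | add x y _ _ hx hy => simp [hx.1, hx.2, hy.1, hy.2]
  | smul a x _ hx =>
    rw [smul_eq_mul, dirDeriv_mul, map_mul, hx.1, hx.2]
    simp

theorem aeval_lineEval (F : MvPolynomial (Fin 5) K) (p : Fin 2 × Fin 5 → Ω) (s t : K) :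
    aeval p (lineEval F s t) =
      aeval (fun j => algebraMap K Ω s * p (0, j) + algebraMap K Ω t * p (1, j)) F := by
  unfold lineEval
  induction F using MvPolynomial.induction_on with
  | C a => simp [MvPolynomial.algebraMap_eq]
  | add f g hf hg => simp only [map_add, hf, hg]
  | mul_X f i hf => rw [map_mul, map_mul, map_mul, hf]; simp

theorem dirDeriv_lineEval (F : MvPolynomial (Fin 5) K) (p p' : Fin 2 × Fin 5 → Ω) (s t : K) :
    dirDeriv p p' (lineEval F s t) =
      dirDeriv (fun j => algebraMap K Ω s * p (0, j) + algebraMap K Ω t * p (1, j))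
        (fun j => algebraMap K Ω s * p' (0, j) + algebraMap K Ω t * p' (1, j)) F := by
  rw [lineEval, dirDeriv_aeval]
  congr 1
  congr 1
  · ext j; simp
  · ext j; rw [map_add, dirDeriv_mul, dirDeriv_mul]; simp

end fano

section gradPoly

variable {K A B : Type} [Field K] [CommRing A] [Algebra K A] [CommRing B] [Algebra K B]

/-- The polynomial `∂ᵢF(v + X w)`. -/
def gradPoly (F : MvPolynomial (Fin 5) K) (v w : Fin 5 → A) (i : Fin 5) : Polynomial A :=
  aeval (fun j => Polynomial.C (v j) + Polynomial.X * Polynomial.C (w j)) (pderiv i F)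

theorem gradPoly_map (φ : A →ₐ[K] B) (F : MvPolynomial (Fin 5) K) (v w : Fin 5 → A) (i : Fin 5) :
    gradPoly F (fun j => φ (v j)) (fun j => φ (w j)) i =
      (gradPoly F v w i).map (φ : A →+* B) := by
  unfold gradPoly
  induction pderiv i F using MvPolynomial.induction_on with
  | C a => simp [Polynomial.algebraMap_apply]
  | add f g hf hg => simp only [map_add, Polynomial.map_add, hf, hg]
  | mul_X f i hf => rw [map_mul, map_mul, Polynomial.map_mul, hf]; simp

end gradPoly

section transversal

variable {K Ω : Type} [Field K] [Field Ω] [Algebra K Ω]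

/-- Some partial derivative of an irreducible form is not divisible by it. -/
theorem exists_not_dvd_pderiv [CharZero K] {n : ℕ} {σ : Type} [Fintype σ] {F : MvPolynomial σ K}
    (hdeg : F.IsHomogeneous n) (hIrr : Irreducible F) : ∃ i, ¬ F ∣ pderiv i F := by
  by_contra! h
  have hn : n ≠ 0 := by
    rintro rfl
    rw [← totalDegree_zero_iff_isHomogeneous, totalDegree_eq_zero_iff_eq_C] at hdeg
    have h0 : coeff 0 F ≠ 0 := fun h0 => hIrr.ne_zero (by rw [hdeg, h0, C_0])
    exact hIrr.not_isUnit (by rw [hdeg]; exact (isUnit_iff_ne_zero.2 h0).map C)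
  have h0 : ∀ i, pderiv i F = 0 := by
    intro i
    by_contra hne
    obtain ⟨g, hg⟩ := h i
    have hg0 : g ≠ 0 := by rintro rfl; exact hne (by rw [hg, mul_zero])
    have h1 := totalDegree_mul_of_isDomain hIrr.ne_zero hg0
    rw [← hg, hdeg.totalDegree hIrr.ne_zero, (hdeg.pderiv (i := i)).totalDegree hne] at h1
    omega
  have h1 := hdeg.sum_X_mul_pderiv
  simp only [h0, mul_zero, Finset.sum_const_zero] at h1
  rw [eq_comm, nsmul_eq_mul, mul_eq_zero] at h1
  exact h1.elim (fun h => hn (by exact_mod_cast h)) hIrr.ne_zero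

/-- The derivative of `F` at `v + X w` in the direction `u`. -/
def gradPair (F : MvPolynomial (Fin 5) K) (v w : Fin 5 → Ω) : (Fin 5 → Ω) →ₗ[Ω] Polynomial Ω where
  toFun u := ∑ i, u i • gradPoly F v w i
  map_add' a b := by simp [add_smul, Finset.sum_add_distrib]
  map_smul' a b := by simp [Finset.smul_sum, smul_smul]

theorem gradPair_apply (F : MvPolynomial (Fin 5) K) (v w u : Fin 5 → Ω) :
    gradPair F v w u = ∑ i, u i • gradPoly F v w i := rfl

theorem eval_aeval_line (f : MvPolynomial (Fin 5) K) (v w : Fin 5 → Ω) (t : Ω) :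
    (aeval (fun j => Polynomial.C (v j) + Polynomial.X * Polynomial.C (w j)) f :
      Polynomial Ω).eval t = aeval (fun j => v j + t * w j) f := by
  induction f using MvPolynomial.induction_on with
  | C a => simp [Polynomial.algebraMap_apply]
  | add f g hf hg => simp only [map_add, Polynomial.eval_add, hf, hg]
  | mul_X f i hf => rw [map_mul, map_mul, Polynomial.eval_mul, hf]; simp [mul_comm t]

theorem eval_gradPair (F : MvPolynomial (Fin 5) K) (v w u : Fin 5 → Ω) (t : Ω) :
    (gradPair F v w u).eval t = dirDeriv (fun j => v j + t * w j) u F := by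
  rw [gradPair_apply, dirDeriv_apply, Polynomial.eval_finsetSum]
  refine Finset.sum_congr rfl fun i _ => ?_
  rw [Polynomial.eval_smul, gradPoly, eval_aeval_line, smul_eq_mul, mul_comm]

/-- A univariate polynomial vanishing at all points of an infinite subfield is zero. -/
theorem polynomial_eq_zero_of_eval_algebraMap [Infinite K] (P : Polynomial Ω)
    (h : ∀ t : K, P.eval (algebraMap K Ω t) = 0) : P = 0 :=
  Polynomial.eq_zero_of_infinite_isRoot P
    ((Set.infinite_range_of_injective (algebraMap K Ω).injective).mono
      (by rintro _ ⟨t, rfl⟩; exact h t))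

theorem aeval_line_eq_zero [Infinite K] {F : MvPolynomial (Fin 5) K} {v w : Fin 5 → Ω}
    (hline : ∀ t : K, aeval (fun j => v j + algebraMap K Ω t * w j) F = 0) :
    (aeval (fun j => Polynomial.C (v j) + Polynomial.X * Polynomial.C (w j)) F :
      Polynomial Ω) = 0 :=
  polynomial_eq_zero_of_eval_algebraMap (K := K) _ fun t => by rw [eval_aeval_line, hline]

theorem gradPair_right [Infinite K] {F : MvPolynomial (Fin 5) K} {v w : Fin 5 → Ω}
    (hline : ∀ t : K, aeval (fun j => v j + algebraMap K Ω t * w j) F = 0) :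
    gradPair F v w w = 0 := by
  have h0 := aeval_line_eq_zero hline
  let D : Derivation K (Polynomial Ω) (Polynomial Ω) :=
    (Polynomial.derivative' (R := Ω)).restrictScalars K
  have h1 := derivation_aeval D
    (fun j => Polynomial.C (v j) + Polynomial.X * Polynomial.C (w j)) F
  rw [h0, map_zero, dirDeriv_apply] at h1
  rw [gradPair_apply, h1]
  refine Finset.sum_congr rfl fun i _ => ?_
  have : D (Polynomial.C (v i) + Polynomial.X * Polynomial.C (w i)) = Polynomial.C (w i) := by
    show Polynomial.derivative _ = _
    simp
  rw [this, Polynomial.smul_eq_C_mul, mul_comm]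
  rfl

theorem gradPair_left [Infinite K] {n : ℕ} {F : MvPolynomial (Fin 5) K}
    (hdeg : F.IsHomogeneous n) {v w : Fin 5 → Ω}
    (hline : ∀ t : K, aeval (fun j => v j + algebraMap K Ω t * w j) F = 0) :
    gradPair F v w v = 0 := by
  have h0 := aeval_line_eq_zero hline
  have h1 := congrArg (aeval (fun j => Polynomial.C (v j) + Polynomial.X * Polynomial.C (w j)))
    hdeg.sum_X_mul_pderiv
  rw [map_nsmul, h0, smul_zero, map_sum] at h1
  have h2 := gradPair_right hline
  rw [gradPair_apply] at h2 ⊢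
  rw [← h1]
  have h3 : ∑ i, v i • gradPoly F v w i =
      ∑ i, v i • gradPoly F v w i + Polynomial.X * ∑ i, w i • gradPoly F v w i := by
    rw [h2]; simp
  rw [h3, Finset.mul_sum, ← Finset.sum_add_distrib]
  refine Finset.sum_congr rfl fun i _ => ?_
  rw [map_mul, aeval_X, Polynomial.smul_eq_C_mul, Polynomial.smul_eq_C_mul, gradPoly]
  ring

/-- A vector tangent to the hypersurface at its generic point `v` extends to a first order
deformation of the line through `v` and `w`. -/
theorem exists_lift [CharZero K] {F : MvPolynomial (Fin 5) K} {v v' : Fin 5 → Ω}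
    (hgen : ∀ f : MvPolynomial (Fin 5) K, aeval v f = 0 → F ∣ f)
    (hv : aeval v F = 0) (h : dirDeriv v v' F = 0) :
    ∃ D : Derivation K Ω Ω, ∀ j, D (v j) = v' j := by
  refine exists_derivation (p := v) fun f hf => ?_
  obtain ⟨g, rfl⟩ := hgen f hf
  rw [dirDeriv_mul, hv, h]
  simp

theorem dirDeriv_of_derivation {F : MvPolynomial (Fin 5) K} {v w : Fin 5 → Ω}
    {s t : K} (hst : aeval (fun j => algebraMap K Ω s * v j + algebraMap K Ω t * w j) F = 0)
    (D : Derivation K Ω Ω) :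
    dirDeriv (fun j => algebraMap K Ω s * v j + algebraMap K Ω t * w j)
      (fun j => algebraMap K Ω s * D (v j) + algebraMap K Ω t * D (w j)) F = 0 := by
  have h1 := derivation_aeval D (fun j => algebraMap K Ω s * v j + algebraMap K Ω t * w j) F
  rw [hst, map_zero] at h1
  rw [h1]
  congr 1
  ext j
  simp

theorem gradPair_lift [CharZero K] {F : MvPolynomial (Fin 5) K} {v w : Fin 5 → Ω}
    (hline : ∀ t : K, aeval (fun j => v j + algebraMap K Ω t * w j) F = 0)
    (D : Derivation K Ω Ω) :
    gradPair F v w (fun j => D (v j)) + Polynomial.X * gradPair F v w (fun j => D (w j)) = 0 := by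
  refine polynomial_eq_zero_of_eval_algebraMap (K := K) _ fun t => ?_
  have h := dirDeriv_of_derivation (F := F) (v := v) (w := w) (s := 1) (t := t)
    (by simpa using hline t) D
  rw [Polynomial.eval_add, Polynomial.eval_mul, Polynomial.eval_X, eval_gradPair, eval_gradPair]
  simp only [map_one, one_mul] at h
  rw [← h]
  simp only [dirDeriv_apply, Finset.mul_sum, ← Finset.sum_add_distrib]
  refine Finset.sum_congr rfl fun i _ => ?_
  ring

end transversal

section extraDirection

variable {K Ω : Type} [Field K] [Field Ω] [Algebra K Ω]

theorem exists_mem_notMem_span {V : Type} [AddCommGroup V] [Module Ω V] [FiniteDimensional Ω V]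
    {m : ℕ} (U : Submodule Ω V) (b : Fin m → V) (h : m < Module.finrank Ω U) :
    ∃ x ∈ U, x ∉ Submodule.span Ω (Set.range b) := by
  by_contra! hle
  have h1 := Submodule.finrank_mono (show U ≤ Submodule.span Ω (Set.range b) from hle)
  have h2 := finrank_range_le_card (R := Ω) b
  rw [Fintype.card_fin] at h2
  rw [Set.finrank] at h2
  omega

theorem finrank_ker_ge {V W : Type} [AddCommGroup V] [Module Ω V] [FiniteDimensional Ω V]
    [AddCommGroup W] [Module Ω W] (f : V →ₗ[Ω] W) (R : Submodule Ω W) [FiniteDimensional Ω R]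
    (hR : LinearMap.range f ≤ R) :
    Module.finrank Ω V ≤ Module.finrank Ω R + Module.finrank Ω (LinearMap.ker f) := by
  have h1 := f.finrank_range_add_finrank_ker
  have h2 := Submodule.finrank_mono hR
  omega

/-- The functional given by a coefficient of `gradPair`. -/
def gradCoeff (F : MvPolynomial (Fin 5) K) (v w : Fin 5 → Ω) : (Fin 5 → Ω) →ₗ[Ω] (Fin 3 → Ω) :=
  LinearMap.pi fun k => (Polynomial.lcoeff Ω k) ∘ₗ gradPair F v w

theorem gradCoeff_apply (F : MvPolynomial (Fin 5) K) (v w u : Fin 5 → Ω) (k : Fin 3) :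
    gradCoeff F v w u k = (gradPair F v w u).coeff k := rfl

theorem finrank_ker_gradCoeff {F : MvPolynomial (Fin 5) K} {v w : Fin 5 → Ω} {c : Fin 3 → Ω}
    (hc : c ≠ 0) (h : ∀ i, ∑ k, c k * (gradPoly F v w i).coeff k = 0) :
    3 ≤ Module.finrank Ω (LinearMap.ker (gradCoeff F v w)) := by
  let l : (Fin 3 → Ω) →ₗ[Ω] Ω := Fintype.linearCombination Ω c
  have hl : ∀ x, l x = ∑ k, x k * c k := fun x => by simp [l, Fintype.linearCombination_apply]
  have hl0 : l ≠ 0 := by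
    intro h0
    apply hc
    ext k
    have := hl (Pi.single k 1)
    rw [h0] at this
    simpa [Pi.single_apply] using this.symm
  have hker : Module.finrank Ω (LinearMap.ker l) = 2 := by
    have h1 := l.finrank_range_add_finrank_ker
    have h2 : LinearMap.range l = ⊤ := LinearMap.range_eq_top.2 (LinearMap.surjective hl0)
    rw [h2, finrank_top, Module.finrank_self, Module.finrank_fin_fun] at h1
    omega
  have hle : LinearMap.range (gradCoeff F v w) ≤ LinearMap.ker l := by
    rintro _ ⟨u, rfl⟩
    rw [LinearMap.mem_ker, hl]
    simp only [gradCoeff_apply, gradPair_apply, Polynomial.finsetSum_coeff,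
      Polynomial.coeff_smul, smul_eq_mul, Finset.sum_mul]
    rw [Finset.sum_comm]
    refine Finset.sum_eq_zero fun i _ => ?_
    rw [← mul_zero (u i), ← h i, Finset.mul_sum]
    exact Finset.sum_congr rfl fun k _ => by ring
  have := finrank_ker_ge (gradCoeff F v w) (LinearMap.ker l) hle
  rw [hker, Module.finrank_fin_fun] at this
  omega

theorem eq_zero_of_elimination {f h k : Polynomial Ω} {c d e c' d' e' : Ω}
    (h1 : f + Polynomial.X * (Polynomial.C c * f + Polynomial.C d * h + Polynomial.C e * k) = 0)
    (h2 : h + Polynomial.X * (Polynomial.C c' * f + Polynomial.C d' * h + Polynomial.C e' * k) = 0)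
    (hf : Polynomial.X ^ 3 ∣ f) (hk : k.coeff 0 ≠ 0) : f = 0 := by
  have key : f * ((1 + Polynomial.C c * Polynomial.X) * (1 + Polynomial.C d' * Polynomial.X)
      - Polynomial.C (c' * d) * Polynomial.X ^ 2) =
      k * (Polynomial.X * (Polynomial.C (-e) + Polynomial.C (d * e' - d' * e) * Polynomial.X)) := by
    simp only [map_mul, map_sub, map_neg]
    linear_combination (1 + Polynomial.C d' * Polynomial.X) * h1 -
      Polynomial.C d * Polynomial.X * h2
  have hXk : ¬ (Polynomial.X : Polynomial Ω) ∣ k := by rwa [Polynomial.X_dvd_iff]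
  have hdvd : (Polynomial.X : Polynomial Ω) ^ 3 ∣
      k * (Polynomial.X * (Polynomial.C (-e) + Polynomial.C (d * e' - d' * e) * Polynomial.X)) :=
    key ▸ hf.mul_right _
  have h3 := Polynomial.prime_X.pow_dvd_of_dvd_mul_left 3 hXk hdvd
  have he : Polynomial.C (-e) + Polynomial.C (d * e' - d' * e) * Polynomial.X = 0 := by
    rw [pow_succ', mul_dvd_mul_iff_left Polynomial.X_ne_zero, Polynomial.X_pow_dvd_iff] at h3
    have e0 := h3 0 (by norm_num)
    have e1 := h3 1 (by norm_num)
    simp only [Polynomial.coeff_add, Polynomial.coeff_C_zero, Polynomial.coeff_mul_X_zero,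
      Polynomial.coeff_C_mul, Polynomial.coeff_X_one, mul_one,
      add_zero, Polynomial.coeff_C_succ, zero_add] at e0 e1
    rw [e0, e1]; simp
  rw [he, mul_zero, mul_zero, mul_eq_zero] at key
  refine key.resolve_right fun h0 => ?_
  have := congrArg (Polynomial.eval 0) h0
  simp at this

/-- If the first three coefficients of the gradient along the line through the generic point are
dependent, then the gradient along the line kills a third direction. -/
theorem exists_extra_direction [CharZero K] {n : ℕ} {F : MvPolynomial (Fin 5) K}
    (hdeg : F.IsHomogeneous n) (hIrr : Irreducible F) {v w : Fin 5 → Ω} {c : Fin 3 → Ω}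
    (hgen : ∀ f : MvPolynomial (Fin 5) K, aeval v f = 0 → F ∣ f) (hv : aeval v F = 0)
    (hline : ∀ t : K, aeval (fun j => v j + algebraMap K Ω t * w j) F = 0)
    (hind : LinearIndependent Ω ![v, w])
    (hc : c ≠ 0) (h : ∀ i, ∑ k, c k * (gradPoly F v w i).coeff k = 0) :
    ∃ u, LinearIndependent Ω ![u, v, w] ∧ gradPair F v w u = 0 := by
  obtain ⟨u, huU, hu⟩ := exists_mem_notMem_span (LinearMap.ker (gradCoeff F v w)) ![v, w]
    (finrank_ker_gradCoeff hc h)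
  have hind3 : LinearIndependent Ω ![u, v, w] := linearIndependent_finCons.2 ⟨hind, hu⟩
  refine ⟨u, hind3, ?_⟩
  let l : (Fin 5 → Ω) →ₗ[Ω] Ω := Polynomial.lcoeff Ω 0 ∘ₗ gradPair F v w
  have hl : ∀ x, l x = (gradPair F v w x).coeff 0 := fun _ => rfl
  have hl' : ∀ x, l x = dirDeriv v x F := fun x => by
    rw [hl, Polynomial.coeff_zero_eq_eval_zero, eval_gradPair]; simp
  obtain ⟨y, hyl, hy⟩ := exists_mem_notMem_span (LinearMap.ker l) ![u, v, w] (by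
    have h1 := finrank_ker_ge l ⊤ le_top
    rw [finrank_top, Module.finrank_self, Module.finrank_fin_fun] at h1
    omega)
  have hind4 : LinearIndependent Ω ![y, u, v, w] := linearIndependent_finCons.2 ⟨hind3, hy⟩
  obtain ⟨i, hi⟩ := exists_not_dvd_pderiv hdeg hIrr
  obtain ⟨z, hz⟩ : ∃ z, l z ≠ 0 := ⟨Pi.single i 1, by
    rw [hl', dirDeriv_apply]
    simpa [Pi.single_apply] using fun h0 => hi (hgen _ h0)⟩
  have hu0 : l u = 0 := congrFun (LinearMap.mem_ker.1 huU) 0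
  have hv0 := gradPair_left hdeg hline
  have hw0 := gradPair_right hline
  have hind5 : LinearIndependent Ω ![z, y, u, v, w] := by
    refine linearIndependent_finCons.2 ⟨hind4, fun hmem => hz ?_⟩
    have : Submodule.span Ω (Set.range ![y, u, v, w]) ≤ LinearMap.ker l := by
      rw [Submodule.span_le]
      rintro _ ⟨j, rfl⟩
      fin_cases j
      · exact hyl
      · exact hu0
      · show l v = 0
        rw [hl, hv0, Polynomial.coeff_zero]
      · show l w = 0
        rw [hl, hw0, Polynomial.coeff_zero]
    exact this hmem
  have hspan := hind5.span_eq_top_of_card_eq_finrank' (by simp)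
  have hexp : ∀ x, ∃ c d e : Ω, gradPair F v w x = Polynomial.C c * gradPair F v w u +
      Polynomial.C d * gradPair F v w y + Polynomial.C e * gradPair F v w z := by
    intro x
    have hx : x ∈ Submodule.span Ω (Set.range ![z, y, u, v, w]) := hspan ▸ Submodule.mem_top
    obtain ⟨a, rfl⟩ := (Submodule.mem_span_range_iff_exists_fun Ω).1 hx
    refine ⟨a 2, a 1, a 0, ?_⟩
    simp only [Fin.sum_univ_five, map_add, map_smul, Polynomial.smul_eq_C_mul]
    simp [hv0, hw0]
    ring
  obtain ⟨D, hD⟩ := exists_lift hgen hv ((hl' u).symm.trans hu0)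
  obtain ⟨D', hD'⟩ := exists_lift hgen hv ((hl' y).symm.trans hyl)
  have e1 := gradPair_lift hline D
  have e2 := gradPair_lift hline D'
  simp only [hD, hD'] at e1 e2
  obtain ⟨c₁, d₁, k₁, h₁⟩ := hexp fun j => D (w j)
  obtain ⟨c₂, d₂, k₂, h₂⟩ := hexp fun j => D' (w j)
  rw [h₁] at e1
  rw [h₂] at e2
  refine eq_zero_of_elimination e1 e2 ?_ hz
  rw [Polynomial.X_pow_dvd_iff]
  exact fun d hd => congrFun (LinearMap.mem_ker.1 huU) ⟨d, hd⟩

end extraDirection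

section dimensionCount

variable {K Ω Ω' : Type} [Field K] [Field Ω] [Algebra K Ω] [Field Ω'] [Algebra K Ω']
  [Algebra Ω Ω'] [IsScalarTower K Ω Ω']

/-- A form vanishing at all `K`-rational points `s v + t w`, `s ≠ 0`, vanishes at all points of
the line, over any extension. -/
theorem sum_aeval_line_eq_zero [Infinite K] {ι : Type} [Fintype ι] (a : ι → Ω)
    (f : ι → MvPolynomial (Fin 5) K) {v w : Fin 5 → Ω}
    (h : ∀ s t : K, s ≠ 0 → ∑ i, a i *
      aeval (fun j => algebraMap K Ω s * v j + algebraMap K Ω t * w j) (f i) = 0) (s t : Ω') :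
    ∑ i, algebraMap Ω Ω' (a i) *
      aeval (fun j => s * algebraMap Ω Ω' (v j) + t * algebraMap Ω Ω' (w j)) (f i) = 0 := by
  let P : ι → MvPolynomial (Fin 2) Ω := fun i => aeval (fun j => X 0 * C (v j) + X 1 * C (w j)) (f i)
  have hP : ∀ (s t : Ω') (i : ι), aeval ![s, t] (P i) =
      aeval (fun j => s * algebraMap Ω Ω' (v j) + t * algebraMap Ω Ω' (w j)) (f i) := by
    intro s t i
    simp only [P]
    induction f i using MvPolynomial.induction_on with
    | C a =>
      rw [aeval_C, aeval_C, IsScalarTower.algebraMap_apply K Ω (MvPolynomial (Fin 2) Ω),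
        MvPolynomial.algebraMap_eq, aeval_C, ← IsScalarTower.algebraMap_apply]
    | add f g hf hg => simp only [map_add, hf, hg]
    | mul_X f i hf => rw [map_mul, map_mul, map_mul, hf]; simp
  have hP' : ∀ (x : Fin 2 → Ω) (i : ι), eval x (P i) =
      aeval (fun j => x 0 * v j + x 1 * w j) (f i) := by
    intro s i
    simp only [P]
    induction f i using MvPolynomial.induction_on with
    | C a =>
      rw [aeval_C, aeval_C, IsScalarTower.algebraMap_apply K Ω (MvPolynomial (Fin 2) Ω),
        MvPolynomial.algebraMap_eq, eval_C]
    | add f g hf hg => simp only [map_add, hf, hg]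
    | mul_X f i hf => rw [map_mul, map_mul, map_mul, hf]; simp
  have h0 : X 0 * ∑ i, C (a i) * P i = 0 := by
    refine eq_zero_of_eval_algebraMap (K := K) _ fun x => ?_
    rw [map_mul, map_sum, eval_X]
    by_cases hx : x 0 = 0
    · simp [hx]
    · simp only [map_mul, eval_C, hP', h _ _ hx, mul_zero]
  have h1 : ∑ i, C (a i) * P i = 0 := (mul_eq_zero.1 h0).resolve_left (X_ne_zero 0)
  have h2 := congrArg (aeval ![s, t]) h1
  simpa only [map_sum, map_mul, aeval_C, hP, map_zero] using h2

theorem aeval_smul_of_isHomogeneous {n : ℕ} {σ : Type} [Fintype σ] {f : MvPolynomial σ K}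
    (hf : f.IsHomogeneous n) (s : Ω) (x : σ → Ω) :
    aeval (fun j => s * x j) f = s ^ n * aeval x f := by
  rw [aeval_def, aeval_def, eval₂_eq', eval₂_eq', Finset.mul_sum]
  refine Finset.sum_congr rfl fun d hd => ?_
  have h1 : ∑ i, d i = n := by
    rw [← hf (mem_support_iff.1 hd), Finsupp.weight_apply, Finsupp.sum_fintype _ _ (by simp)]
    simp
  simp only [mul_pow, Finset.prod_mul_distrib, Finset.prod_pow_eq_pow_sum, h1]
  ring

/-- Vanishing of the gradient pairing along `v + X w` spreads to the whole line. -/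
theorem dirDeriv_line_eq_zero [Infinite K] {n : ℕ} {F : MvPolynomial (Fin 5) K}
    (hdeg : F.IsHomogeneous n) {v w u : Fin 5 → Ω} (hu : gradPair F v w u = 0) (s t : Ω') :
    dirDeriv (fun j => s * algebraMap Ω Ω' (v j) + t * algebraMap Ω Ω' (w j))
      (fun j => algebraMap Ω Ω' (u j)) F = 0 := by
  have := sum_aeval_line_eq_zero (K := K) (Ω' := Ω') u (fun i => pderiv i F) (v := v) (w := w)
    (fun s t hs => ?_) s t
  · rw [dirDeriv_apply, ← this]
    exact Finset.sum_congr rfl fun i _ => mul_comm _ _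
  · have hs' : algebraMap K Ω s ≠ 0 := by simpa using hs
    have h1 := congrArg (Polynomial.eval (algebraMap K Ω t / algebraMap K Ω s)) hu
    rw [eval_gradPair, Polynomial.eval_zero, dirDeriv_apply] at h1
    have h2 : (fun j => algebraMap K Ω s * v j + algebraMap K Ω t * w j) =
        fun j => algebraMap K Ω s * (v j + algebraMap K Ω t / algebraMap K Ω s * w j) := by
      ext j; field_simp
    rw [h2, ← mul_zero (algebraMap K Ω s ^ (n - 1)), ← h1, Finset.mul_sum]
    refine Finset.sum_congr rfl fun i _ => ?_
    rw [aeval_smul_of_isHomogeneous (hdeg.pderiv)]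
    ring

theorem aeval_line_eq_zero' [Infinite K] {F : MvPolynomial (Fin 5) K} {v w : Fin 5 → Ω}
    (hline : ∀ s t : K, aeval (fun j => algebraMap K Ω s * v j + algebraMap K Ω t * w j) F = 0)
    (s t : Ω') :
    aeval (fun j => s * algebraMap Ω Ω' (v j) + t * algebraMap Ω Ω' (w j)) F = 0 := by
  simpa using sum_aeval_line_eq_zero (K := K) (Ω' := Ω') (ι := Unit) (fun _ => 1) (fun _ => F)
    (v := v) (w := w) (fun s t _ => by simpa using hline s t) s t

theorem linearIndependent_algebraMap {m : ℕ} {ι : Type} [Fintype ι] {x : Fin m → ι → Ω}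
    (hx : LinearIndependent Ω x) :
    LinearIndependent Ω' (fun k => fun j => algebraMap Ω Ω' (x k j)) := by
  classical
  have hinj : LinearMap.ker (Fintype.linearCombination Ω x) = ⊥ :=
    LinearMap.ker_eq_bot.2 (linearIndependent_iff_injective_fintypeLinearCombination.1 hx)
  obtain ⟨L, hL⟩ := LinearMap.exists_leftInverse_of_injective _ hinj
  have hLx : ∀ k l, L (x k) l = if k = l then 1 else 0 := by
    intro k l
    have := congrFun (LinearMap.congr_fun hL (Pi.single k 1)) l
    simpa [Fintype.linearCombination_apply, Pi.single_apply, eq_comm] using this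
  rw [Fintype.linearIndependent_iff]
  intro g hg l
  have h1 : ∀ k, ∑ j, algebraMap Ω Ω' (L (fun i => if j = i then 1 else 0) l) *
      algebraMap Ω Ω' (x k j) = if k = l then 1 else 0 := by
    intro k
    have := congrFun (LinearMap.pi_apply_eq_sum_univ L (x k)) l
    rw [hLx, Finset.sum_apply] at this
    have h2 := congrArg (algebraMap Ω Ω') this
    rw [map_sum] at h2
    rw [apply_ite (algebraMap Ω Ω'), map_one, map_zero] at h2
    rw [h2]
    refine Finset.sum_congr rfl fun j _ => ?_
    rw [Pi.smul_apply, smul_eq_mul, map_mul, mul_comm]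
  have h2 : ∑ k, g k * ∑ j, algebraMap Ω Ω' (L (fun i => if j = i then 1 else 0) l) *
      algebraMap Ω Ω' (x k j) = 0 := by
    simp only [Finset.mul_sum]
    rw [Finset.sum_comm]
    refine Finset.sum_eq_zero fun j _ => ?_
    have h3 := congrFun hg j
    rw [Finset.sum_apply, Pi.zero_apply] at h3
    rw [← mul_zero (algebraMap Ω Ω' (L (fun i => if j = i then 1 else 0) l)), ← h3, Finset.mul_sum]
    refine Finset.sum_congr rfl fun k _ => ?_
    rw [Pi.smul_apply, smul_eq_mul]
    ring
  simpa [h1] using h2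

/-- Vectors of the tangent space to the family of frames fixing the generic first vector add to
the four dimensions coming from the first vector. -/
theorem finrank_tangentSpace_ge [CharZero K] {F : MvPolynomial (Fin 5) K}
    {p : Fin 2 × Fin 5 → Ω}
    (hgen : ∀ f : MvPolynomial (Fin 5) K, aeval (fun j => p (0, j)) f = 0 → F ∣ f)
    (hv : aeval (fun j => p (0, j)) F = 0) {m : ℕ} (x : Fin m → Fin 5 → Ω)
    (hx : LinearIndependent Ω x)
    (hmem : ∀ k, (fun ij : Fin 2 × Fin 5 => if ij.1 = 0 then 0 else x k ij.2) ∈ tangentSpace K p) :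
    4 + m ≤ Module.finrank Ω (tangentSpace K p) := by
  let π : tangentSpace K p →ₗ[Ω] (Fin 5 → Ω) :=
    (LinearMap.pi fun j => LinearMap.proj (0, j)) ∘ₗ (tangentSpace K p).subtype
  have h1 := π.finrank_range_add_finrank_ker
  let l : (Fin 5 → Ω) →ₗ[Ω] Ω := Fintype.linearCombination Ω
    (fun i => aeval (fun j => p (0, j)) (pderiv i F))
  have hl : ∀ x, l x = dirDeriv (fun j => p (0, j)) x F := fun x => by
    simp [l, Fintype.linearCombination_apply, dirDeriv_apply, mul_comm]
  have h2 : 4 ≤ Module.finrank Ω (LinearMap.range π) := by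
    have h3 := finrank_ker_ge l ⊤ le_top
    rw [finrank_top, Module.finrank_self, Module.finrank_fin_fun] at h3
    have h4 : LinearMap.ker l ≤ LinearMap.range π := by
      intro v' hv'
      obtain ⟨D, hD⟩ := exists_lift hgen hv ((hl v').symm.trans hv')
      exact ⟨⟨fun ij => D (p ij), derivation_mem_tangentSpace D p⟩, funext hD⟩
    have h5 := Submodule.finrank_mono h4
    omega
  let y : Fin m → LinearMap.ker π := fun k => ⟨⟨_, hmem k⟩, by
    rw [LinearMap.mem_ker]; ext j; simp [π]⟩
  have hy : LinearIndependent Ω y := by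
    let ρ : LinearMap.ker π →ₗ[Ω] (Fin 5 → Ω) :=
      (LinearMap.pi fun j => LinearMap.proj (1, j)) ∘ₗ (tangentSpace K p).subtype ∘ₗ
        (LinearMap.ker π).subtype
    refine LinearIndependent.of_comp ρ ?_
    convert hx using 1
    ext k j
    simp [ρ, y]
  have h6 := hy.fintype_card_le_finrank
  rw [Fintype.card_fin] at h6
  omega

theorem derivation_algebraMap_tangentSpace [CharZero Ω] {a : Fin 2 → Ω'}
    (ha : AlgebraicIndependent Ω a) (a' : Fin 2 → Ω') :
    ∃ D : Derivation K Ω' Ω', (∀ k, D (a k) = a' k) ∧ ∀ y, D (algebraMap Ω Ω' y) = 0 := by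
  obtain ⟨D, hD⟩ := exists_derivation (K := Ω) (p := a) (p' := a') fun f hf => by
    rw [(algebraicIndependent_iff.1 ha) f hf, map_zero]
  exact ⟨D.restrictScalars K, hD, fun y => D.map_algebraMap y⟩

theorem false_of_extra_direction [CharZero K] {n : ℕ} {F : MvPolynomial (Fin 5) K}
    (hdeg : F.IsHomogeneous n) (hred : FanoGenerallyReduced K F)
    (hdim : ∀ P : Ideal (MvPolynomial (Fin 2 × Fin 5) K), P.IsPrime → fanoIdeal K F ≤ P →
      ringKrullDim (MvPolynomial (Fin 2 × Fin 5) K ⧸ P) ≤ ((6 : ℕ) : WithBot ℕ∞))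
    {v w u : Fin 5 → Ω} (hgen : ∀ f : MvPolynomial (Fin 5) K, aeval v f = 0 → F ∣ f)
    (hline : ∀ s t : K, aeval (fun j => algebraMap K Ω s * v j + algebraMap K Ω t * w j) F = 0)
    (hind : LinearIndependent Ω ![u, v, w]) (hu : gradPair F v w u = 0)
    {a : Fin 2 → Ω'} (ha : AlgebraicIndependent Ω a) : False := by
  have : CharZero Ω := charZero_of_injective_algebraMap (algebraMap K Ω).injective
  let p : Fin 2 × Fin 5 → Ω' := fun ij => if ij.1 = 0 then algebraMap Ω Ω' (v ij.2) else
    a 0 * algebraMap Ω Ω' (w ij.2) + a 1 * algebraMap Ω Ω' (v ij.2)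
  have hp0 : (fun j => p (0, j)) = fun j => algebraMap Ω Ω' (v j) := rfl
  have hp1 : ∀ j, p (1, j) = a 0 * algebraMap Ω Ω' (w j) + a 1 * algebraMap Ω Ω' (v j) :=
    fun j => rfl
  have hgen' : ∀ f : MvPolynomial (Fin 5) K, aeval (fun j => p (0, j)) f = 0 → F ∣ f := by
    intro f hf
    rw [hp0] at hf
    have h1 := aeval_algebraMap_apply Ω' v f
    rw [show (algebraMap Ω Ω' ∘ v) = fun j => algebraMap Ω Ω' (v j) from rfl, hf] at h1
    exact hgen f ((map_eq_zero _).1 h1.symm)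
  have hzero := aeval_line_eq_zero' (Ω' := Ω') hline
  have hv' : aeval (fun j => p (0, j)) F = 0 := by
    rw [hp0]; simpa using hzero 1 0
  have hindΩ : LinearIndependent Ω' (fun k => fun j => algebraMap Ω Ω' (![u, v, w] k j)) :=
    linearIndependent_algebraMap hind
  have hcomb : ∀ s t : K, (fun j => algebraMap K Ω' s * p (0, j) + algebraMap K Ω' t * p (1, j)) =
      fun j => (algebraMap K Ω' s + algebraMap K Ω' t * a 1) * algebraMap Ω Ω' (v j) +
        (algebraMap K Ω' t * a 0) * algebraMap Ω Ω' (w j) := by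
    intro s t
    ext j
    rw [hp1, congrFun hp0 j]
    ring
  have hpI : ∀ s t : K, aeval p (lineEval F s t) = 0 := by
    intro s t
    rw [aeval_lineEval, hcomb]
    exact hzero _ _
  have hfix : ∀ x : Fin 5 → Ω', ∀ D : Derivation K Ω' Ω', (∀ y, D (algebraMap Ω Ω' y) = 0) →
      (∀ j, D (p (1, j)) = x j) →
      (fun ij : Fin 2 × Fin 5 => if ij.1 = 0 then 0 else x ij.2) ∈ tangentSpace K p := by
    intro x D h0 h1
    convert derivation_mem_tangentSpace D p using 1
    ext ⟨i, j⟩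
    fin_cases i
    · exact (h0 _).symm
    · exact (h1 j).symm
  have hDv : (fun ij : Fin 2 × Fin 5 => if ij.1 = 0 then 0 else algebraMap Ω Ω' (v ij.2)) ∈
      tangentSpace K p := by
    obtain ⟨D, hD, hD0⟩ := derivation_algebraMap_tangentSpace (K := K) ha ![0, 1]
    refine hfix (fun j => algebraMap Ω Ω' (v j)) D hD0 fun j => ?_
    rw [hp1]
    simp [hD0, hD]
  have hDw : (fun ij : Fin 2 × Fin 5 => if ij.1 = 0 then 0 else algebraMap Ω Ω' (w ij.2)) ∈
      tangentSpace K p := by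
    obtain ⟨D, hD, hD0⟩ := derivation_algebraMap_tangentSpace (K := K) ha ![1, 0]
    refine hfix (fun j => algebraMap Ω Ω' (w j)) D hD0 fun j => ?_
    rw [hp1]
    simp [hD0, hD]
  have h6 : 6 ≤ Module.finrank Ω' (tangentSpace K p) := by
    refine finrank_tangentSpace_ge hgen' hv' _ (hindΩ.comp Fin.succ (Fin.succ_injective _)) ?_
    intro k
    fin_cases k
    · exact hDv
    · exact hDw
  have hI := forall_mem_fanoIdeal F p
    (fun ij : Fin 2 × Fin 5 => if ij.1 = 0 then 0 else algebraMap Ω Ω' (u ij.2)) hpI (by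
      intro s t
      rw [dirDeriv_lineEval, hcomb]
      have h1 := dirDeriv_line_eq_zero (Ω' := Ω') hdeg hu
        (algebraMap K Ω' s + algebraMap K Ω' t * a 1) (algebraMap K Ω' t * a 0)
      rw [dirDeriv_apply] at h1 ⊢
      refine Eq.trans ?_ ((congrArg (algebraMap K Ω' t * ·) h1).trans (mul_zero _))
      simp only [Finset.mul_sum]
      refine Finset.sum_congr rfl fun i _ => ?_
      simp
      ring)
  have hDu := mem_tangentSpace_of_genericallyReduced hred hdim (fun f hf => (hI f hf).1) h6
    (fun f hf => (hI f hf).2)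
  have h7 : 4 + 3 ≤ Module.finrank Ω' (tangentSpace K p) := by
    refine finrank_tangentSpace_ge hgen' hv' _ hindΩ ?_
    intro k
    fin_cases k
    · exact hDu
    · exact hDv
    · exact hDw
  have h8 := (finrank_tangentSpace_le (K := K) p).trans
    (hdim _ (RingHom.ker_isPrime _) fun f hf => (hI f hf).1)
  have h9 : Module.finrank Ω' (tangentSpace K p) ≤ 6 := by exact_mod_cast h8
  omega

end dimensionCount

section fanoDimension

variable {K : Type} [Field K]

theorem aeval_lineEval_self (F : MvPolynomial (Fin 5) K) (p : Fin 2 × Fin 5 → K) (s t : K) :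
    eval p (lineEval F s t) = eval (fun j => s * p (0, j) + t * p (1, j)) F := by
  have := aeval_lineEval (Ω := K) F p s t
  simpa [aeval_eq_eval] using this

theorem mem_frameCone_of_eval_lineEval {F : MvPolynomial (Fin 5) K}
    (hcov : CoveredByLines K F) (hne : (projZeros K (N := 4) F).Nonempty)
    {p : Fin 2 × Fin 5 → K} (hp : ∀ s t, eval p (lineEval F s t) = 0) :
    p ∈ frameCone K 2 4 (fanoSet K F) := by
  simp only [aeval_lineEval_self] at hp
  by_cases hind : LinearIndependent K ![fun j => p (0, j), fun j => p (1, j)]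
  · refine ⟨⟨Submodule.span K (Set.range ![fun j => p (0, j), fun j => p (1, j)]), ?_⟩, ?_, ?_⟩
    · rw [finrank_span_eq_card hind, Fintype.card_fin]
    · intro x hx v hv
      obtain ⟨a, rfl⟩ := (Submodule.mem_span_range_iff_exists_fun K).1 (hx hv)
      rw [← hp (a 0) (a 1)]
      congr 2
      ext j
      simp [Fin.sum_univ_two]
    · intro i
      refine Submodule.subset_span ⟨i, ?_⟩
      fin_cases i <;> rfl
  · suffices h : ∃ x ∈ projZeros K (N := 4) F,
        (fun j => p (0, j)) ∈ x.submodule ∧ (fun j => p (1, j)) ∈ x.submodule by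
      obtain ⟨x, hx, h0, h1⟩ := h
      obtain ⟨W, hW, hxW⟩ := hcov x hx
      refine ⟨W, hW, fun i => hxW ?_⟩
      fin_cases i
      · exact h0
      · exact h1
    by_cases h0 : (fun j => p (0, j)) = 0
    · by_cases h1 : (fun j => p (1, j)) = 0
      · obtain ⟨x, hx⟩ := hne
        exact ⟨x, hx, h0 ▸ zero_mem _, h1 ▸ zero_mem _⟩
      · refine ⟨Projectivization.mk K _ h1, ?_, h0 ▸ zero_mem _, ?_⟩
        · intro y hy
          rw [Projectivization.submodule_mk, Submodule.mem_span_singleton] at hy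
          obtain ⟨c, rfl⟩ := hy
          rw [← hp 0 c]
          congr 2
          ext j
          simp
        · rw [Projectivization.submodule_mk]
          exact Submodule.mem_span_singleton_self _
    · rw [LinearIndependent.pair_iff' h0] at hind
      push Not at hind
      obtain ⟨a, ha⟩ := hind
      refine ⟨Projectivization.mk K _ h0, ?_, ?_, ?_⟩
      · intro y hy
        rw [Projectivization.submodule_mk, Submodule.mem_span_singleton] at hy
        obtain ⟨c, rfl⟩ := hy
        rw [← hp c 0]
        congr 2
        ext j
        simp
      · rw [Projectivization.submodule_mk]
        exact Submodule.mem_span_singleton_self _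
      · rw [Projectivization.submodule_mk, Submodule.mem_span_singleton]
        exact ⟨a, ha⟩

theorem ringKrullDim_le_six [IsAlgClosed K] {F : MvPolynomial (Fin 5) K}
    (hcov : CoveredByLines K F) (hne : (projZeros K (N := 4) F).Nonempty)
    (hdim : HasGrDim K (fanoSet K F) 2) (P : Ideal (MvPolynomial (Fin 2 × Fin 5) K))
    (hP : P.IsPrime) (hle : fanoIdeal K F ≤ P) :
    ringKrullDim (MvPolynomial (Fin 2 × Fin 5) K ⧸ P) ≤ ((6 : ℕ) : WithBot ℕ∞) := by
  have h1 : affVanishing K (frameCone K 2 4 (fanoSet K F)) ≤ P := by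
    intro f hf
    refine (hP.radical_le_iff.2 hle) ?_
    rw [← vanishingIdeal_zeroLocus_eq_radical (K := K)]
    intro x hx
    rw [aeval_eq_eval]
    refine hf x (mem_frameCone_of_eval_lineEval hcov hne fun s t => ?_)
    have := hx _ (lineEval_mem_fanoIdeal F s t)
    rwa [aeval_eq_eval] at this
  have h2 : affDim K (frameCone K 2 4 (fanoSet K F)) = ((6 : ℕ) : WithBot ℕ∞) := hdim
  rw [← h2]
  exact ringKrullDim_le_of_surjective (Ideal.Quotient.factor h1) (Ideal.Quotient.factor_surjective h1)

end fanoDimension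

section genericPoint

variable {K : Type} [Field K]

theorem exists_eval_ne_zero_of_not_dvd [IsAlgClosed K] {σ : Type} [Finite σ]
    {F G : MvPolynomial σ K} (hF : Prime F) (hG : ¬ F ∣ G) :
    ∃ x : σ → K, eval x F = 0 ∧ eval x G ≠ 0 := by
  by_contra! h
  have hp : (Ideal.span {F}).IsPrime := (Ideal.span_singleton_prime hF.ne_zero).2 hF
  apply hG
  rw [← Ideal.mem_span_singleton, ← hp.radical, ← vanishingIdeal_zeroLocus_eq_radical (K := K)]
  intro x hx
  rw [aeval_eq_eval]
  refine h x ?_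
  have := hx F (Ideal.mem_span_singleton_self F)
  rwa [aeval_eq_eval] at this

/-- If over a general point of a hypersurface a system of equations and inequations is solvable,
then it is solvable over the generic point. -/
theorem exists_generic_solution [IsAlgClosed K] {σ ρ ι : Type} [Finite σ] [Finite ρ] [Fintype ι]
    {F G : MvPolynomial σ K} (hF : Prime F) (hG : ¬ F ∣ G)
    (S : Set (MvPolynomial (σ ⊕ ρ) K)) (e : ι → MvPolynomial (σ ⊕ ρ) K)
    (h : ∀ x : σ → K, eval x F = 0 → eval x G ≠ 0 → ∃ y : ρ → K,
      (∀ f ∈ S, eval (Sum.elim x y) f = 0) ∧ ∃ i, eval (Sum.elim x y) (e i) ≠ 0) :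
    ∃ (Ω : Type) (_ : Field Ω) (_ : Algebra K Ω) (q : σ ⊕ ρ → Ω),
      (∀ f ∈ S, aeval q f = 0) ∧ (∃ i, aeval q (e i) ≠ 0) ∧
      ∀ f : MvPolynomial σ K, aeval (fun j => q (Sum.inl j)) f = 0 → F ∣ f := by
  have hp : (Ideal.span {F}).IsPrime := (Ideal.span_singleton_prime hF.ne_zero).2 hF
  let M : ι → Submonoid (MvPolynomial (σ ⊕ ρ) K) := fun i =>
    (Ideal.span {F}).primeCompl.map (rename Sum.inl : MvPolynomial σ K →ₐ[K] _) ⊔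
      Submonoid.powers (e i)
  by_cases hdis : ∃ i, Disjoint (Ideal.span S : Set (MvPolynomial (σ ⊕ ρ) K)) (M i)
  · obtain ⟨i, hi⟩ := hdis
    obtain ⟨P, hP, hSP, hdP⟩ := Ideal.exists_le_prime_disjoint _ _ hi
    let q : σ ⊕ ρ → FractionRing (MvPolynomial (σ ⊕ ρ) K ⧸ P) := fun j =>
      algebraMap (MvPolynomial (σ ⊕ ρ) K ⧸ P) _ (Ideal.Quotient.mk P (X j))
    have hq : ∀ f : MvPolynomial (σ ⊕ ρ) K,
        aeval q f = algebraMap (MvPolynomial (σ ⊕ ρ) K ⧸ P) _ (Ideal.Quotient.mk P f) := by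
      intro f
      have : (aeval q : MvPolynomial (σ ⊕ ρ) K →ₐ[K] _) =
          (IsScalarTower.toAlgHom K (MvPolynomial (σ ⊕ ρ) K ⧸ P)
            (FractionRing (MvPolynomial (σ ⊕ ρ) K ⧸ P))).comp (Ideal.Quotient.mkₐ K P) := by
        ext j; simp [q]
      rw [this]; rfl
    have hq0 : ∀ f : MvPolynomial (σ ⊕ ρ) K, aeval q f = 0 ↔ f ∈ P := by
      intro f
      rw [hq, ← Ideal.Quotient.eq_zero_iff_mem, map_eq_zero_iff _
        (IsFractionRing.injective (MvPolynomial (σ ⊕ ρ) K ⧸ P) _)]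
    refine ⟨_, inferInstance, inferInstance, q,
      fun f hf => (hq0 f).2 (hSP (Ideal.subset_span hf)), ⟨i, fun h0 => ?_⟩, fun f hf => ?_⟩
    · exact Set.disjoint_left.1 hdP ((hq0 _).1 h0)
        (Submonoid.mem_sup_right (Submonoid.mem_powers _))
    · by_contra hFf
      have h1 : aeval q (rename Sum.inl f) = 0 := by
        rw [aeval_rename]; exact hf
      refine Set.disjoint_left.1 hdP ((hq0 _).1 h1) (Submonoid.mem_sup_left ⟨f, ?_, rfl⟩)
      exact fun hmem => hFf (Ideal.mem_span_singleton.1 hmem)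
  · exfalso
    push Not at hdis
    have h1 : ∀ i, ∃ s : MvPolynomial σ K, ∃ k : ℕ, ¬ F ∣ s ∧
        rename Sum.inl s * e i ^ k ∈ Ideal.span S := by
      intro i
      obtain ⟨z, hz, hzM⟩ := Set.not_disjoint_iff.1 (hdis i)
      obtain ⟨y, ⟨s, hs, rfl⟩, _, ⟨k, rfl⟩, rfl⟩ := Submonoid.mem_sup.1 hzM
      exact ⟨s, k, fun hd => hs (Ideal.mem_span_singleton.2 hd), hz⟩
    choose s k hs hsk using h1
    have hprod : ¬ F ∣ G * ∏ i, s i := by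
      intro hd
      rcases hF.dvd_or_dvd hd with hd | hd
      · exact hG hd
      · obtain ⟨i, -, hi⟩ := (hF.dvd_finsetProd_iff s).1 hd
        exact hs i hi
    obtain ⟨x, hx, hGx⟩ := exists_eval_ne_zero_of_not_dvd hF hprod
    rw [map_mul, map_prod, mul_ne_zero_iff, Finset.prod_ne_zero_iff] at hGx
    obtain ⟨y, hy, i, hi⟩ := h x hx hGx.1
    have h2 : Ideal.span S ≤ RingHom.ker (eval (Sum.elim x y)) := Ideal.span_le.2 hy
    have h3 := RingHom.mem_ker.1 (h2 (hsk i))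
    rw [map_mul, map_pow, eval_rename, Sum.elim_comp_inl] at h3
    exact mul_ne_zero (hGx.2 i (Finset.mem_univ i)) (pow_ne_zero _ hi) h3

theorem exists_minor_ne_zero {Ω : Type} [Field Ω] {v w : Fin 5 → Ω}
    (h : LinearIndependent Ω ![v, w]) : ∃ i j, v i * w j - v j * w i ≠ 0 := by
  by_contra! h0
  have hv : v ≠ 0 := h.ne_zero 0
  rw [LinearIndependent.pair_iff' hv] at h
  obtain ⟨i, hi⟩ := Function.ne_iff.1 hv
  refine h (w i / v i) ?_
  ext j
  rw [Pi.smul_apply, smul_eq_mul]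
  have := h0 i j
  rw [Pi.zero_apply] at hi
  field_simp
  linear_combination -this

theorem linearIndependent_of_minor {Ω : Type} [Field Ω] {v w : Fin 5 → Ω} {i j : Fin 5}
    (h : v i * w j - v j * w i ≠ 0) : LinearIndependent Ω ![v, w] := by
  rw [LinearIndependent.pair_iff]
  intro s t hst
  have hi := congrFun hst i
  have hj := congrFun hst j
  simp only [Pi.add_apply, Pi.smul_apply, smul_eq_mul, Pi.zero_apply] at hi hj
  constructor
  · refine (mul_eq_zero.1 (?_ : s * (v i * w j - v j * w i) = 0)).resolve_right h
    linear_combination w j * hi - w i * hj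
  · refine (mul_eq_zero.1 (?_ : t * (v i * w j - v j * w i) = 0)).resolve_right h
    linear_combination v i * hj - v j * hi

theorem exists_generic_line [IsAlgClosed K] {F G : MvPolynomial (Fin 5) K} (hF : Irreducible F)
    (hG : ¬ F ∣ G)
    (h : ∀ v : Fin 5 → K, eval v F = 0 → eval v G ≠ 0 → ∃ (w : Fin 5 → K) (c : Fin 3 → K),
      LinearIndependent K ![v, w] ∧ c ≠ 0 ∧
      (∀ s t : K, eval (fun j => s * v j + t * w j) F = 0) ∧
      ∀ i, ∑ k, c k * (gradPoly F v w i).coeff k = 0) :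
    ∃ (Ω : Type) (_ : Field Ω) (_ : Algebra K Ω) (v w : Fin 5 → Ω) (c : Fin 3 → Ω),
      LinearIndependent Ω ![v, w] ∧ c ≠ 0 ∧
      (∀ s t : K, aeval (fun j => algebraMap K Ω s * v j + algebraMap K Ω t * w j) F = 0) ∧
      (∀ i, ∑ k, c k * (gradPoly F v w i).coeff k = 0) ∧
      ∀ f : MvPolynomial (Fin 5) K, aeval v f = 0 → F ∣ f := by
  let R := MvPolynomial (Fin 5 ⊕ (Fin 5 ⊕ Fin 3)) K
  let v₀ : Fin 5 → R := fun j => X (Sum.inl j)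
  let w₀ : Fin 5 → R := fun j => X (Sum.inr (Sum.inl j))
  let c₀ : Fin 3 → R := fun j => X (Sum.inr (Sum.inr j))
  let line : K → K → R := fun s t => aeval (fun j => C s * v₀ j + C t * w₀ j) F
  let grad : Fin 5 → R := fun i => ∑ k : Fin 3, c₀ k * (gradPoly F v₀ w₀ i).coeff k
  let e : Fin 5 × Fin 5 × Fin 3 → R := fun x =>
    (v₀ x.1 * w₀ x.2.1 - v₀ x.2.1 * w₀ x.1) * c₀ x.2.2
  have hline : ∀ {Ω : Type} [Field Ω] [Algebra K Ω] (q : Fin 5 ⊕ (Fin 5 ⊕ Fin 3) → Ω) (s t : K),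
      aeval q (line s t) = aeval (fun j => algebraMap K Ω s * q (Sum.inl j) +
        algebraMap K Ω t * q (Sum.inr (Sum.inl j))) F := by
    intro Ω _ _ q s t
    have : (aeval q).comp (aeval (fun j => C s * v₀ j + C t * w₀ j)) =
        (aeval (fun j => algebraMap K Ω s * q (Sum.inl j) +
          algebraMap K Ω t * q (Sum.inr (Sum.inl j))) : MvPolynomial (Fin 5) K →ₐ[K] Ω) := by
      ext j; simp [v₀, w₀]
    exact DFunLike.congr_fun this F
  have hgrad : ∀ {Ω : Type} [Field Ω] [Algebra K Ω] (q : Fin 5 ⊕ (Fin 5 ⊕ Fin 3) → Ω) (i : Fin 5),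
      aeval q (grad i) = ∑ k : Fin 3, q (Sum.inr (Sum.inr k)) *
        (gradPoly F (fun j => q (Sum.inl j)) (fun j => q (Sum.inr (Sum.inl j))) i).coeff k := by
    intro Ω _ _ q i
    have h1 := gradPoly_map (aeval q) F v₀ w₀ i
    simp only [v₀, w₀, aeval_X] at h1
    simp only [grad, c₀, map_sum, map_mul, aeval_X, h1, Polynomial.coeff_map]
    rfl
  have he : ∀ {Ω : Type} [Field Ω] [Algebra K Ω] (q : Fin 5 ⊕ (Fin 5 ⊕ Fin 3) → Ω) (x),
      aeval q (e x) = (q (Sum.inl x.1) * q (Sum.inr (Sum.inl x.2.1)) -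
        q (Sum.inl x.2.1) * q (Sum.inr (Sum.inl x.1))) * q (Sum.inr (Sum.inr x.2.2)) := by
    intro Ω _ _ q x
    simp [e, v₀, w₀, c₀]
  obtain ⟨Ω, _, _, q, hqS, ⟨x, hx⟩, hgen⟩ := exists_generic_solution hF.prime hG
    ({f | ∃ s t, f = line s t} ∪ Set.range grad) e (by
      intro v hv hGv
      obtain ⟨w, c, hind, hc, hl, hg⟩ := h v hv hGv
      obtain ⟨i, j, hij⟩ := exists_minor_ne_zero hind
      obtain ⟨k, hk⟩ := Function.ne_iff.1 hc
      refine ⟨Sum.elim w c, ?_, ⟨i, j, k⟩, ?_⟩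
      · rintro f (⟨s, t, rfl⟩ | ⟨i, rfl⟩)
        · rw [← aeval_eq_eval, hline]
          simpa [aeval_eq_eval] using hl s t
        · rw [← aeval_eq_eval, hgrad]
          exact hg i
      · rw [← aeval_eq_eval, he]
        exact mul_ne_zero hij hk)
  rw [he] at hx
  refine ⟨Ω, _, _, fun j => q (Sum.inl j), fun j => q (Sum.inr (Sum.inl j)),
    fun k => q (Sum.inr (Sum.inr k)), linearIndependent_of_minor (left_ne_zero_of_mul hx),
    fun h0 => right_ne_zero_of_mul hx (congrFun h0 x.2.2), fun s t => ?_, fun i => ?_, hgen⟩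
  · rw [← hline]
    exact hqS _ (Or.inl ⟨s, t, rfl⟩)
  · rw [← hgrad]
    exact hqS _ (Or.inr ⟨i, rfl⟩)

end genericPoint

section binaryForms

variable {K : Type} [Field K]

/-- A binary form with `n` coefficients and `n` pairwise non-proportional zeros vanishes. -/
theorem binaryForm_eq_zero {n : ℕ} {y z f : Fin n → K}
    (hne : ∀ i j, i ≠ j → y i * z j ≠ y j * z i)
    (h : ∀ i, ∑ k : Fin n, f k * (z i ^ (k : ℕ) * y i ^ (k.rev : ℕ)) = 0) : f = 0 := by
  refine Matrix.eq_zero_of_mulVec_eq_zero (M := Matrix.projVandermonde z y) ?_ ?_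
  · rw [Matrix.det_projVandermonde]
    refine Finset.prod_ne_zero_iff.2 fun i _ => Finset.prod_ne_zero_iff.2 fun j hj => ?_
    have hij : i ≠ j := (Finset.mem_Ioi.1 hj).ne
    exact sub_ne_zero.2 fun h0 => hne i j hij (by rw [mul_comm (y i), mul_comm (y j)]; exact h0)
  · ext i
    rw [Matrix.mulVec, dotProduct, Pi.zero_apply, ← h i]
    exact Finset.sum_congr rfl fun k _ => by rw [Matrix.projVandermonde_apply, mul_comm]

theorem binaryCubic_eq_zero {ι : Type} {s : Finset ι} (hs : 4 ≤ s.card) {y z : ι → K}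
    (hne : ∀ i ∈ s, ∀ j ∈ s, i ≠ j → y i * z j ≠ y j * z i) {a b c d : K}
    (h : ∀ i ∈ s, a * y i ^ 3 + b * y i ^ 2 * z i + c * y i * z i ^ 2 + d * z i ^ 3 = 0) :
    a = 0 ∧ b = 0 ∧ c = 0 ∧ d = 0 := by
  obtain ⟨f⟩ : Nonempty (Fin 4 ↪ s) := Function.Embedding.nonempty_of_card_le (by simpa using hs)
  have h0 : ![a, b, c, d] = 0 := by
    refine binaryForm_eq_zero (y := fun i => y (f i)) (z := fun i => z (f i))
      (fun i j hij => hne _ (f i).2 _ (f j).2 fun h0 => hij (f.injective (Subtype.ext h0)))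
      fun i => ?_
    rw [← h _ (f i).2]
    simp [Fin.sum_univ_four, Fin.rev]
    ring
  exact ⟨congrFun h0 0, congrFun h0 1, congrFun h0 2, congrFun h0 3⟩

/-- A plane conic `xy + βy² + δyz + γz²` and a plane cubic, smooth at the common point `(1, 0, 0)`
and transversal to the axes chosen there, have at most six further common points unless the conic
and the cubic share the line `x + βy + δz = 0`. -/
theorem exists_common_line {x y z : Fin 7 → K}
    (hne : ∀ i j, i ≠ j → ¬ (x i * y j = x j * y i ∧ x i * z j = x j * z i ∧ y i * z j = y j * z i))
    {β γ δ a₁ a₂ a₃ c₀ c₁ c₂ c₃ : K}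
    (h0 : y 0 = 0 ∧ z 0 = 0)
    (hq : ∀ i, x i * y i + β * y i ^ 2 + δ * y i * z i + γ * z i ^ 2 = 0)
    (hc : ∀ i, x i ^ 2 * z i + x i * (a₁ * y i ^ 2 + a₂ * y i * z i + a₃ * z i ^ 2) +
      (c₀ * y i ^ 3 + c₁ * y i ^ 2 * z i + c₂ * y i * z i ^ 2 + c₃ * z i ^ 3) = 0) :
    γ = 0 ∧ (∃ i, x i = -(β * y i + δ * z i)) ∧
      -a₁ * β + c₀ = 0 ∧ β ^ 2 - a₁ * δ - a₂ * β + c₁ = 0 ∧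
      2 * β * δ - a₂ * δ - a₃ * β + c₂ = 0 ∧ δ ^ 2 - a₃ * δ + c₃ = 0 := by
  have hγ : γ = 0 := by
    by_contra hγ
    have hy : ∀ i : Fin 6, y i.succ ≠ 0 := by
      intro i hi
      have h1 := hq i.succ
      rw [hi] at h1
      have h2 : z i.succ = 0 := by simpa [hγ] using h1
      exact hne _ _ (Fin.succ_ne_zero i) (by rw [hi, h2, h0.1, h0.2]; simp)
    have := binaryForm_eq_zero (y := fun i : Fin 6 => y i.succ) (z := fun i : Fin 6 => z i.succ)
      (f := ![-a₁ * β + c₀, β ^ 2 - a₁ * δ - a₂ * β + c₁, 2 * β * δ - a₁ * γ - a₂ * δ - a₃ * β + c₂,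
        δ ^ 2 + 2 * β * γ - a₂ * γ - a₃ * δ + c₃, 2 * δ * γ - a₃ * γ, γ ^ 2])
      (fun i j hij h1 => ?_) (fun i => ?_)
    · have h2 := congrFun this 5
      exact hγ (by simpa using h2)
    · have hx : x i.succ * y j.succ = x j.succ * y i.succ := by
        refine mul_right_cancel₀ (mul_ne_zero (hy i) (hy j)) ?_
        linear_combination y j.succ ^ 2 * hq i.succ - y i.succ ^ 2 * hq j.succ
          + (δ * y i.succ * y j.succ + γ * (z i.succ * y j.succ + z j.succ * y i.succ)) * h1
      refine hne _ _ (fun h2 => hij (Fin.succ_injective _ h2)) ⟨hx, ?_, h1⟩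
      refine mul_right_cancel₀ (hy j) ?_
      linear_combination z j.succ * hx + x j.succ * h1
    · simp [Fin.sum_univ_succ, Fin.rev]
      have h1 := hq i.succ
      have h2 := hc i.succ
      generalize y i.succ = Y at *
      generalize x i.succ = X at *
      generalize z i.succ = Z at *
      linear_combination Y ^ 2 * h2 - (X * Y * Z - (β * Y ^ 2 + δ * Y * Z + γ * Z ^ 2) * Z
        + Y * (a₁ * Y ^ 2 + a₂ * Y * Z + a₃ * Z ^ 2)) * h1
  subst hγ
  classical
  let s := Finset.univ.filter fun i => y i = 0
  have hs : s.card ≤ 3 := by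
    by_contra! hs
    have := binaryCubic_eq_zero (s := s) hs (y := x) (z := z) (a := 0) (b := 1) (c := a₃) (d := c₃)
      (fun i hi j hj hij h1 => ?_) (fun i hi => ?_)
    · exact one_ne_zero this.2.1
    · simp only [s, Finset.mem_filter, Finset.mem_univ, true_and] at hi hj
      exact hne i j hij ⟨by simp [hi, hj], h1, by simp [hi, hj]⟩
    · simp only [s, Finset.mem_filter, Finset.mem_univ, true_and] at hi
      have h2 := hc i
      rw [hi] at h2
      linear_combination h2
  have hs' : 4 ≤ sᶜ.card := by
    rw [Finset.card_compl, Fintype.card_fin]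
    omega
  have hx : ∀ i ∈ sᶜ, x i = -(β * y i + δ * z i) := by
    intro i hi
    simp only [s, Finset.mem_compl, Finset.mem_filter, Finset.mem_univ, true_and] at hi
    refine mul_right_cancel₀ hi ?_
    linear_combination hq i
  have := binaryCubic_eq_zero (s := sᶜ) hs' (y := y) (z := z) (a := -a₁ * β + c₀)
    (b := β ^ 2 - a₁ * δ - a₂ * β + c₁) (c := 2 * β * δ - a₂ * δ - a₃ * β + c₂)
    (d := δ ^ 2 - a₃ * δ + c₃) (fun i hi j hj hij h1 => ?_) (fun i hi => ?_)
  · obtain ⟨i, hi⟩ := Finset.card_pos.1 (by omega : 0 < sᶜ.card)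
    exact ⟨rfl, ⟨i, hx i hi⟩, this⟩
  · refine hne i j hij ⟨?_, ?_, h1⟩
    · rw [hx i hi, hx j hj]
      linear_combination δ * h1
    · rw [hx i hi, hx j hj]
      linear_combination -β * h1
  · have h2 := hc i
    rw [hx i hi] at h2
    linear_combination h2

end binaryForms

section localExpansion

variable {K : Type} [Field K]

theorem coeff_aeval_X_mul_C {σ : Type} [Fintype σ] (a : σ → K) (G : MvPolynomial σ K) (k : ℕ) :
    (aeval (fun m => Polynomial.X * Polynomial.C (a m)) G : Polynomial K).coeff k =
      eval a (homogeneousComponent k G) := by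
  induction G using MvPolynomial.induction_on' with
  | add f g hf hg => simp only [map_add, Polynomial.coeff_add, hf, hg]
  | monomial d r =>
    have h1 : (aeval (fun m => Polynomial.X * Polynomial.C (a m)) (monomial d r) : Polynomial K) =
        Polynomial.C (eval a (monomial d r)) * Polynomial.X ^ d.degree := by
      simp only [aeval_monomial, eval_monomial, Finsupp.prod, mul_pow, Finset.prod_mul_distrib,
        Finset.prod_pow_eq_pow_sum, map_mul, map_prod, map_pow, Finsupp.degree_apply,
        Polynomial.algebraMap_eq]
      ring
    rw [h1, Polynomial.coeff_C_mul_X_pow,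
      homogeneousComponent_of_mem (isHomogeneous_monomial (d := d) r rfl)]
    split_ifs <;> simp

theorem homogeneousComponent_pderiv {σ : Type} (m : σ) (G : MvPolynomial σ K) (k : ℕ) :
    homogeneousComponent k (pderiv m G) = pderiv m (homogeneousComponent (k + 1) G) := by
  induction G using MvPolynomial.induction_on' with
  | add f g hf hg => simp only [map_add, hf, hg]
  | monomial d r =>
    rw [homogeneousComponent_of_mem (isHomogeneous_monomial (d := d) r rfl),
      homogeneousComponent_of_mem (isHomogeneous_monomial (d := d) r rfl).pderiv]
    rcases Nat.eq_zero_or_pos d.degree with hd | hd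
    · rw [(Finsupp.degree_eq_zero_iff d).1 hd]
      simp
    · split_ifs <;> first | rfl | (exfalso; omega)

/-- Every form of positive degree is a combination of the coordinates with coefficients forms of
degree one less. -/
theorem exists_eq_sum_mul_X [CharZero K] {σ : Type} [Fintype σ] {n : ℕ} {p : MvPolynomial σ K}
    (hp : p.IsHomogeneous (n + 1)) :
    ∃ g : σ → MvPolynomial σ K, (∀ m, (g m).IsHomogeneous n) ∧ p = ∑ m, g m * X m := by
  refine ⟨fun m => C ((n + 1 : K)⁻¹) * pderiv m p, fun m => ?_, ?_⟩
  · have := (isHomogeneous_C σ ((n + 1 : K)⁻¹)).mul (hp.pderiv (i := m))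
    simpa using this
  · have h := hp.sum_X_mul_pderiv
    have h1 : p = C ((n + 1 : K)⁻¹) * ∑ m, X m * pderiv m p := by
      rw [h, nsmul_eq_mul, ← mul_assoc, ← map_natCast (C : K →+* MvPolynomial σ K), ← C_mul]
      rw [Nat.cast_add, Nat.cast_one, inv_mul_cancel₀ (Nat.cast_add_one_ne_zero n), C_1, one_mul]
    conv_lhs => rw [h1]
    rw [Finset.mul_sum]
    exact Finset.sum_congr rfl fun m _ => by ring

theorem exists_quadratic_coeffs [CharZero K] {σ : Type} [Fintype σ] {p : MvPolynomial σ K}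
    (hp : p.IsHomogeneous 2) : ∃ b : σ → σ → K, p = ∑ i, ∑ j, C (b i j) * X j * X i := by
  obtain ⟨g, hg, rfl⟩ := exists_eq_sum_mul_X hp
  choose h hh hh' using fun i => exists_eq_sum_mul_X (hg i)
  refine ⟨fun i j => coeff 0 (h i j), Finset.sum_congr rfl fun i _ => ?_⟩
  rw [hh' i, Finset.sum_mul]
  refine Finset.sum_congr rfl fun j _ => ?_
  rw [← totalDegree_eq_zero_iff_eq_C.1 ((totalDegree_zero_iff_isHomogeneous σ).2 (hh i j))]

theorem exists_cubic_coeffs [CharZero K] {σ : Type} [Fintype σ] {p : MvPolynomial σ K}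
    (hp : p.IsHomogeneous 3) :
    ∃ a : σ → σ → σ → K, p = ∑ i, ∑ j, ∑ k, C (a i j k) * X k * X j * X i := by
  obtain ⟨g, hg, rfl⟩ := exists_eq_sum_mul_X hp
  choose b hb using fun i => exists_quadratic_coeffs (hg i)
  refine ⟨b, Finset.sum_congr rfl fun i _ => ?_⟩
  rw [hb i, Finset.sum_mul]
  exact Finset.sum_congr rfl fun j _ => by rw [Finset.sum_mul]

/-- The polynomial `F(v + ∑ xₘ eₘ)`. -/
def planeExpansion (F : MvPolynomial (Fin 5) K) (v : Fin 5 → K) (e : Fin 3 → Fin 5 → K) :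
    MvPolynomial (Fin 3) K :=
  aeval (fun j => C (v j) + ∑ m, C (e m j) * X m) F

theorem aeval_plane (G : MvPolynomial (Fin 5) K) (v : Fin 5 → K)
    (e : Fin 3 → Fin 5 → K) (a : Fin 3 → K) :
    (aeval (fun m => Polynomial.X * Polynomial.C (a m)) (planeExpansion G v e) : Polynomial K) =
      aeval (fun j => Polynomial.C (v j) + Polynomial.X * Polynomial.C ((∑ m, a m • e m) j)) G := by
  rw [planeExpansion, ← AlgHom.comp_apply, comp_aeval]
  congr 2
  ext1 j
  simp only [map_add, map_sum, map_mul, aeval_X, algHom_C, Polynomial.algebraMap_eq,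
    Finset.sum_apply, Pi.smul_apply, smul_eq_mul, Finset.mul_sum]
  congr 1
  exact Finset.sum_congr rfl fun m _ => by ring

theorem pderiv_planeExpansion (F : MvPolynomial (Fin 5) K) (v : Fin 5 → K)
    (e : Fin 3 → Fin 5 → K) (m : Fin 3) :
    pderiv m (planeExpansion F v e) = ∑ i, C (e m i) * planeExpansion (pderiv i F) v e := by
  have h := derivation_aeval (pderiv (R := K) m) (fun j => C (v j) + ∑ m, C (e m j) * X m) F
  rw [planeExpansion, h, dirDeriv_apply]
  refine Finset.sum_congr rfl fun i _ => ?_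
  rw [mul_comm]
  simp [planeExpansion, pderiv_X, Pi.single_apply]

theorem coeff_gradPair_eq (F : MvPolynomial (Fin 5) K) (v : Fin 5 → K)
    (e : Fin 3 → Fin 5 → K) (a : Fin 3 → K) (m : Fin 3) (k : ℕ) :
    (gradPair F v (∑ m, a m • e m) (e m)).coeff k =
      eval a (pderiv m (homogeneousComponent (k + 1) (planeExpansion F v e))) := by
  rw [← homogeneousComponent_pderiv, ← coeff_aeval_X_mul_C, pderiv_planeExpansion, gradPair_apply]
  simp only [gradPoly, ← aeval_plane, map_sum, map_mul, algHom_C, Polynomial.smul_eq_C_mul,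
    Polynomial.algebraMap_eq]

end localExpansion

section sevenLines

variable {K : Type} [Field K]

theorem exists_relation_of_not_surjective {F : MvPolynomial (Fin 5) K} {v w : Fin 5 → K}
    (h : ¬ Function.Surjective (gradCoeff F v w)) :
    ∃ c : Fin 3 → K, c ≠ 0 ∧ ∀ i, ∑ k, c k * (gradPoly F v w i).coeff k = 0 := by
  rw [← LinearMap.range_eq_top, ← ne_eq, ← lt_top_iff_ne_top] at h
  obtain ⟨f, hf, hle⟩ := Submodule.exists_le_ker_of_lt_top _ h
  have hf' : ∀ x, f x = ∑ k, x k * f (Pi.single k 1) := fun x => by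
    conv_lhs => rw [pi_eq_sum_univ' x]
    simp
  refine ⟨fun k => f (Pi.single k 1), fun h0 => hf ?_, fun i => ?_⟩
  · ext k
    simpa using congrFun h0 k
  · have h1 : f (gradCoeff F v w (Pi.single i 1)) = 0 := hle ⟨_, rfl⟩
    rw [hf'] at h1
    rw [← h1]
    refine Finset.sum_congr rfl fun k _ => ?_
    rw [gradCoeff_apply, gradPair_apply, mul_comm]
    simp [Pi.single_apply]

theorem finrank_ker_of_surjective {f : (Fin 5 → K) →ₗ[K] (Fin 3 → K)}
    (h : Function.Surjective f) : Module.finrank K (LinearMap.ker f) = 2 := by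
  have h1 := f.finrank_range_add_finrank_ker
  rw [LinearMap.range_eq_top.2 h, finrank_top, Module.finrank_fin_fun, Module.finrank_fin_fun] at h1
  omega

theorem mem_span_pair_of_surjective {f : (Fin 5 → K) →ₗ[K] (Fin 3 → K)}
    (h : Function.Surjective f) {v w u : Fin 5 → K} (hind : LinearIndependent K ![v, w])
    (hv : f v = 0) (hw : f w = 0) (hu : f u = 0) : ∃ a b : K, a • v + b • w = u := by
  by_contra! h0
  have hu' : u ∉ Submodule.span K (Set.range ![v, w]) := by
    rw [Matrix.range_cons_cons_empty, Submodule.mem_span_pair]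
    push Not
    exact h0
  have h3 := finrank_span_eq_card (linearIndependent_finCons.2 ⟨hind, hu'⟩)
  have h4 : Submodule.span K (Set.range (Fin.cons u ![v, w])) ≤ LinearMap.ker f := by
    rw [Submodule.span_le]
    rintro _ ⟨j, rfl⟩
    fin_cases j
    · exact hu
    · exact hv
    · exact hw
  have h5 := Submodule.finrank_mono h4
  rw [h3, finrank_ker_of_surjective h] at h5
  simp at h5

/-- Among seven lines through a point of the hypersurface, in pairwise distinct directions, or
in the span of two of them, there is a line along which the tangent hyperplane varies, to second
order at the point, in a pencil. -/
theorem exists_relation_of_seven_lines [CharZero K] {n : ℕ}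
    {F : MvPolynomial (Fin 5) K} (hdeg : F.IsHomogeneous n) {v : Fin 5 → K} {w : Fin 7 → Fin 5 → K}
    (hind : ∀ i j, i ≠ j → LinearIndependent K ![v, w i, w j])
    (hline : ∀ i, ∀ s t : K, eval (fun j => s * v j + t * w i j) F = 0) :
    ∃ (w : Fin 5 → K) (c : Fin 3 → K), LinearIndependent K ![v, w] ∧ c ≠ 0 ∧
      (∀ s t : K, eval (fun j => s * v j + t * w j) F = 0) ∧
      ∀ i, ∑ k, c k * (gradPoly F v w i).coeff k = 0 := by
  by_contra hcon
  have hsurj : ∀ w, LinearIndependent K ![v, w] →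
      (∀ s t : K, eval (fun j => s * v j + t * w j) F = 0) →
      Function.Surjective (gradCoeff F v w) := by
    intro w hw hl
    by_contra hns
    obtain ⟨c, hc, h⟩ := exists_relation_of_not_surjective hns
    exact hcon ⟨w, c, hw, hc, hl, h⟩
  have hline' : ∀ w : Fin 5 → K, (∀ s t : K, eval (fun j => s * v j + t * w j) F = 0) →
      ∀ t : K, aeval (fun j => v j + algebraMap K K t * w j) F = 0 := by
    intro w hl t
    have := hl 1 t
    simp only [one_mul] at this
    exact this
  have hind2 : ∀ i, LinearIndependent K ![v, w i] := by
    intro i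
    obtain ⟨j, hj⟩ := exists_ne i
    have := (hind i j hj.symm).comp ![0, 1] (by decide)
    convert this using 1
    ext m
    fin_cases m <;> rfl
  have hker : ∀ w, (∀ s t : K, eval (fun j => s * v j + t * w j) F = 0) →
      gradCoeff F v w v = 0 ∧ gradCoeff F v w w = 0 := by
    intro w hl
    constructor
    · ext k
      rw [gradCoeff_apply, gradPair_left hdeg (hline' w hl)]; rfl
    · ext k
      rw [gradCoeff_apply, gradPair_right (hline' w hl)]; rfl
  have hzero : ∀ w w' u, gradCoeff F v w u 0 = gradCoeff F v w' u 0 := by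
    intro w w' u
    simp only [gradCoeff_apply, Fin.val_zero, Polynomial.coeff_zero_eq_eval_zero, eval_gradPair]
    simp
  let g := gradCoeff F v (w 0)
  have hg : Function.Surjective g := hsurj _ (hind2 0) (hline 0)
  obtain ⟨e₁, he₁⟩ := hg ![0, 1, 0]
  obtain ⟨e₂, he₂⟩ := hg ![0, 0, 1]
  have hdec : ∀ i, ∃ α x : K,
      w i = α • v + x • w 0 + g (w i) 1 • e₁ + g (w i) 2 • e₂ := by
    intro i
    obtain ⟨α, x, h⟩ := mem_span_pair_of_surjective hg (hind2 0) (hker _ (hline 0)).1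
      (hker _ (hline 0)).2 (u := w i - (g (w i) 1 • e₁ + g (w i) 2 • e₂)) (by
        rw [map_sub, map_add, map_smul, map_smul, he₁, he₂]
        ext k
        fin_cases k
        · have := congrFun (hker _ (hline i)).2 0
          rw [hzero _ (w 0)] at this
          simpa using this
        · simp
        · simp)
    exact ⟨α, x, by rw [h]; abel⟩
  choose α x hx using hdec
  let e : Fin 3 → Fin 5 → K := ![w 0, e₁, e₂]
  let p : Fin 7 → Fin 3 → K := fun i => ![x i, g (w i) 1, g (w i) 2]
  have hsum : ∀ i, ∑ m, p i m • e m = w i - α i • v := by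
    intro i
    rw [Fin.sum_univ_three]
    conv_rhs => rw [hx i]
    simp only [p, e, Matrix.cons_val_zero, Matrix.cons_val_one, Matrix.cons_val]
    abel
  have hlp : ∀ i, ∀ s t : K, eval (fun j => s * v j + t * (∑ m, p i m • e m) j) F = 0 := by
    intro i s t
    rw [hsum, ← hline i (s - t * α i) t]
    congr 2
    ext j
    simp only [Pi.sub_apply, Pi.smul_apply, smul_eq_mul]
    ring
  have hcomp : ∀ i k, eval (p i) (homogeneousComponent k (planeExpansion F v e)) = 0 := by
    intro i k
    rw [← coeff_aeval_X_mul_C, aeval_plane, aeval_line_eq_zero (hline' _ (hlp i)),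
      Polynomial.coeff_zero]
  have hgrad : ∀ (a : Fin 3 → K) m (k : Fin 3), gradCoeff F v (∑ m, a m • e m) (e m) k =
      eval a (pderiv m (homogeneousComponent (k + 1) (planeExpansion F v e))) :=
    fun a m k => coeff_gradPair_eq F v e a m k
  have hne : ∀ i j, i ≠ j → ¬ (x i * g (w j) 1 = x j * g (w i) 1 ∧
      x i * g (w j) 2 = x j * g (w i) 2 ∧ g (w i) 1 * g (w j) 2 = g (w j) 1 * g (w i) 2) := by
    rintro i j hij ⟨h1, h2, h3⟩
    have hp : ∀ m m', p j m * p i m' = p i m * p j m' := by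
      intro m m'
      fin_cases m <;> fin_cases m' <;>
        simp only [p, Fin.zero_eta, Fin.mk_one, Fin.reduceFinMk, Matrix.cons_val_zero,
          Matrix.cons_val_one, Matrix.cons_val] <;>
        first
          | ring1
          | linear_combination h1
          | linear_combination -h1
          | linear_combination h2
          | linear_combination -h2
          | linear_combination h3
          | linear_combination -h3
    have hz : ∀ m, p j m = 0 := by
      intro m
      have h4 : p j m • (w i - α i • v) - p i m • (w j - α j • v) = 0 := by
        rw [← hsum, ← hsum, Finset.smul_sum, Finset.smul_sum, ← Finset.sum_sub_distrib]
        refine Finset.sum_eq_zero fun m' _ => ?_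
        rw [smul_smul, smul_smul, hp, sub_self]
      have h5 := Fintype.linearIndependent_iff.1 (hind i j hij)
        ![p i m * α j - p j m * α i, p j m, -p i m] (by
          rw [Fin.sum_univ_three, ← h4]
          simp only [Matrix.cons_val_zero, Matrix.cons_val_one, Matrix.cons_val]
          module) 1
      simpa using h5
    have h6 := hsum j
    simp only [hz, zero_smul, Finset.sum_const_zero] at h6
    have h7 := LinearIndependent.pair_iff.1 (hind2 j) (-α j) 1 (by
      rw [h6]; module)
    exact one_ne_zero h7.2
  obtain ⟨b, hb⟩ := exists_quadratic_coeffs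
    (homogeneousComponent_isHomogeneous 2 (planeExpansion F v e))
  obtain ⟨a, ha⟩ := exists_cubic_coeffs
    (homogeneousComponent_isHomogeneous 3 (planeExpansion F v e))
  have he0 : ∑ m, (![1, 0, 0] : Fin 3 → K) m • e m = w 0 := by
    simp [Fin.sum_univ_three, e]
  have hq : ∀ (s : Fin 3 → K) m, gradCoeff F v (∑ m, s m • e m) (e m) 1 =
      eval s (pderiv m (∑ i, ∑ j, C (b i j) * X j * X i)) := fun s m => by
    rw [← hb]; exact hgrad s m 1
  have hc : ∀ (s : Fin 3 → K) m, gradCoeff F v (∑ m, s m • e m) (e m) 2 =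
      eval s (pderiv m (∑ i, ∑ j, ∑ k, C (a i j k) * X k * X j * X i)) := fun s m => by
    rw [← ha]; exact hgrad s m 2
  have hq0 := hq ![1, 0, 0]
  have hc0 := hc ![1, 0, 0]
  rw [he0] at hq0 hc0
  have hge0 : g (e 0) = 0 := (hker _ (hline 0)).2
  have hge1 : g (e 1) = ![0, 1, 0] := he₁
  have hge2 : g (e 2) = ![0, 0, 1] := he₂
  have hq00 := (congrFun hge0 1).symm.trans (hq0 0)
  have hq01 := (congrFun hge1 1).symm.trans (hq0 1)
  have hq02 := (congrFun hge2 1).symm.trans (hq0 2)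
  have hc00 := (congrFun hge0 2).symm.trans (hc0 0)
  have hc01 := (congrFun hge1 2).symm.trans (hc0 1)
  have hc02 := (congrFun hge2 2).symm.trans (hc0 2)
  simp [Fin.sum_univ_three, pderiv_X] at hq00 hq01 hq02 hc00 hc01 hc02
  have hb0 : b 0 0 = 0 := by
    refine (mul_eq_zero.1 (?_ : (2 : K) * b 0 0 = 0)).resolve_left two_ne_zero
    linear_combination -hq00
  have ha0 : a 0 0 0 = 0 := by
    refine (mul_eq_zero.1 (?_ : (3 : K) * a 0 0 0 = 0)).resolve_left three_ne_zero
    linear_combination -hc00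
  have hpq := fun i => hcomp i 2
  have hpc := fun i => hcomp i 3
  rw [hb] at hpq
  rw [ha] at hpc
  simp only [p, Fin.sum_univ_three, map_add, map_mul, eval_C, eval_X, Matrix.cons_val_zero,
    Matrix.cons_val_one, Matrix.cons_val] at hpq hpc
  obtain ⟨hγ, ⟨i, hi⟩, h0, h1, h2, h3⟩ := exists_common_line (β := b 1 1) (δ := b 1 2 + b 2 1)
    (γ := b 2 2) (a₁ := a 0 1 1 + a 1 0 1 + a 1 1 0)
    (a₂ := a 0 1 2 + a 0 2 1 + a 1 0 2 + a 1 2 0 + a 2 0 1 + a 2 1 0)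
    (a₃ := a 0 2 2 + a 2 0 2 + a 2 2 0) (c₀ := a 1 1 1) (c₁ := a 1 1 2 + a 1 2 1 + a 2 1 1)
    (c₂ := a 1 2 2 + a 2 1 2 + a 2 2 1) (c₃ := a 2 2 2)
    hne ⟨congrFun hge0 1, congrFun hge0 2⟩
    (fun i => by
      linear_combination hpq i - x i ^ 2 * hb0 + x i * g (w i) 1 * hq01 + x i * g (w i) 2 * hq02)
    (fun i => by
      linear_combination hpc i - x i ^ 3 * ha0 + x i ^ 2 * g (w i) 1 * hc01 +
        x i ^ 2 * g (w i) 2 * hc02)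
  let w' : Fin 5 → K := ∑ m, p i m • e m
  let u₁ := e 1 - b 1 1 • e 0
  let u₂ := e 2 - (b 1 2 + b 2 1) • e 0
  have hw' : LinearIndependent K ![v, w'] := by
    rw [LinearIndependent.pair_iff]
    intro s t hst
    have h4 := LinearIndependent.pair_iff.1 (hind2 i) (s - t * α i) t (by
      rw [← hst]
      simp only [w', hsum]
      module)
    refine ⟨?_, h4.2⟩
    simpa [h4.2] using h4.1
  have hq' := hq (p i)
  have hc' := hc (p i)
  have hk0 : ∀ m, gradCoeff F v w' (e m) 0 = 0 := by
    intro m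
    rw [hzero _ (w 0)]
    fin_cases m
    · exact congrFun hge0 0
    · exact congrFun hge1 0
    · exact congrFun hge2 0
  have hu₁ : gradCoeff F v w' u₁ = 0 := by
    ext k
    rw [map_sub, map_smul]
    fin_cases k
    · simp [hk0]
    · simp only [Fin.mk_one, Pi.sub_apply, Pi.smul_apply, smul_eq_mul, w', hq']
      simp [Fin.sum_univ_three, pderiv_X, p]
      linear_combination hi - (x i - b 1 1 * g (w i) 1) * hq01 + b 1 1 * g (w i) 2 * hq02 -
        2 * b 1 1 * x i * hb0
    · simp only [Fin.reduceFinMk, Pi.sub_apply, Pi.smul_apply, smul_eq_mul, w', hc']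
      simp [Fin.sum_univ_three, pderiv_X, p]
      linear_combination 3 * g (w i) 1 ^ 2 * h0 + 2 * g (w i) 1 * g (w i) 2 * h1 + g (w i) 2 ^ 2 * h2 +
        (2 * (a 0 1 1 + a 1 0 1 + a 1 1 0) * g (w i) 1 +
          (a 0 1 2 + a 0 2 1 + a 1 0 2 + a 1 2 0 + a 2 0 1 + a 2 1 0) * g (w i) 2 -
          2 * b 1 1 * g (w i) 2) * hi - (x i ^ 2 - 2 * b 1 1 * x i * g (w i) 1) * hc01 +
        2 * b 1 1 * x i * g (w i) 2 * hc02 - 3 * b 1 1 * x i ^ 2 * ha0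
  have hu₂ : gradCoeff F v w' u₂ = 0 := by
    ext k
    rw [map_sub, map_smul]
    fin_cases k
    · simp [hk0]
    · simp only [Fin.mk_one, Pi.sub_apply, Pi.smul_apply, smul_eq_mul, w', hq']
      simp [Fin.sum_univ_three, pderiv_X, p]
      linear_combination (b 1 2 + b 2 1) * g (w i) 1 * hq01 + ((b 1 2 + b 2 1) * g (w i) 2 - x i) * hq02 +
        2 * g (w i) 2 * hγ - 2 * (b 1 2 + b 2 1) * x i * hb0
    · simp only [Fin.reduceFinMk, Pi.sub_apply, Pi.smul_apply, smul_eq_mul, w', hc']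
      simp [Fin.sum_univ_three, pderiv_X, p]
      linear_combination g (w i) 1 ^ 2 * h1 + 2 * g (w i) 1 * g (w i) 2 * h2 + 3 * g (w i) 2 ^ 2 * h3 +
        (x i - (b 1 1 * g (w i) 1 + (b 1 2 + b 2 1) * g (w i) 2) +
          (a 0 1 2 + a 0 2 1 + a 1 0 2 + a 1 2 0 + a 2 0 1 + a 2 1 0) * g (w i) 1 +
          2 * (a 0 2 2 + a 2 0 2 + a 2 2 0) * g (w i) 2 - 2 * (b 1 2 + b 2 1) * g (w i) 2) * hi +
        2 * (b 1 2 + b 2 1) * x i * g (w i) 1 * hc01 +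
        (2 * (b 1 2 + b 2 1) * x i * g (w i) 2 - x i ^ 2) * hc02 -
        3 * (b 1 2 + b 2 1) * x i ^ 2 * ha0
  have hgu : g (e 1 - b 1 1 • e 0) = ![0, 1, 0] := by rw [map_sub, map_smul, hge0, hge1]; simp
  have hgu' : g u₂ = ![0, 0, 1] := by simp only [u₂]; rw [map_sub, map_smul, hge0, hge2]; simp
  have hgv : g v = 0 := (hker _ (hline 0)).1
  have hv0 : v ≠ 0 := (hind2 0).ne_zero 0
  have hsp := mem_span_pair_of_surjective (hsurj w' hw' (hlp i)) (v := v) (w := u₁) (by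
    rw [LinearIndependent.pair_iff' hv0]
    intro c hc
    have := congrFun (congrArg g hc) 1
    rw [map_smul, hgv, hgu] at this
    simp at this) (hker _ (hlp i)).1 hu₁ hu₂
  obtain ⟨c, d, hcd⟩ := hsp
  have := congrFun (congrArg g hcd) 2
  rw [map_add, map_smul, map_smul, hgv, hgu, hgu'] at this
  simp at this

end sevenLines

section glue

variable {K : Type} [Field K]

theorem eval_smul_eq_zero {n N : ℕ} {F : MvPolynomial (Fin (N + 1)) K} (hdeg : F.IsHomogeneous n)
    {v : Fin (N + 1) → K} (hv : eval v F = 0) (s : K) : eval (s • v) F = 0 := by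
  have := aeval_smul_of_isHomogeneous (Ω := K) hdeg s v
  simp only [aeval_eq_eval] at this
  exact this.trans (by rw [hv, mul_zero])

theorem mk_mem_projZeros {n N : ℕ} {F : MvPolynomial (Fin (N + 1)) K} (hdeg : F.IsHomogeneous n)
    {v : Fin (N + 1) → K} (hv0 : v ≠ 0) (hv : eval v F = 0) :
    Projectivization.mk K v hv0 ∈ projZeros K F := by
  intro u hu
  rw [Projectivization.submodule_mk, Submodule.mem_span_singleton] at hu
  obtain ⟨s, rfl⟩ := hu
  exact eval_smul_eq_zero hdeg hv s

theorem eval_eq_zero_of_mem_fanoSet {n : ℕ} {F : MvPolynomial (Fin 5) K} (hdeg : F.IsHomogeneous n)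
    {v : Fin 5 → K} (hv : eval v F = 0) {W : Grass K 2 4} (hW : W ∈ fanoSet K F) {u : Fin 5 → K}
    (hu : u ∈ W.1) : eval u F = 0 := by
  by_cases hu0 : u = 0
  · subst hu0
    simpa using eval_smul_eq_zero hdeg hv 0
  · refine hW (a := Projectivization.mk K u hu0) ?_ u ?_
    · change (Projectivization.mk K u hu0).submodule ≤ W.1
      rw [Projectivization.submodule_mk, Submodule.span_singleton_le_iff_mem]
      exact hu
    · rw [Projectivization.submodule_mk]
      exact Submodule.mem_span_singleton_self u

/-- Distinct planes through a nonzero vector `v` have independent directions modulo `v`. -/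
theorem exists_directions {ι : Type} {v : Fin 5 → K} (hv : v ≠ 0) (W : ι → Grass K 2 4)
    (hW : Function.Injective W) (hvW : ∀ i, v ∈ (W i).1) :
    ∃ w : ι → Fin 5 → K, (∀ i, w i ∈ (W i).1) ∧
      ∀ i j, i ≠ j → LinearIndependent K ![v, w i, w j] := by
  have h : ∀ i, ∃ w ∈ (W i).1, w ∉ Submodule.span K (Set.range ![v]) := fun i =>
    exists_mem_notMem_span (W i).1 ![v] (by rw [(W i).2]; norm_num)
  choose w hwW hw using h
  have hspan : ∀ i, Submodule.span K (Set.range ![w i, v]) = (W i).1 := by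
    intro i
    have hind : LinearIndependent K ![w i, v] :=
      linearIndependent_finCons.2 ⟨linearIndependent_unique_iff.2 hv, hw i⟩
    refine Submodule.eq_of_le_of_finrank_eq ?_ ?_
    · rw [Submodule.span_le]
      rintro _ ⟨j, rfl⟩
      fin_cases j
      · exact hwW i
      · exact hvW i
    · rw [finrank_span_eq_card hind, (W i).2]
      rfl
  refine ⟨w, hwW, fun i j hij => ?_⟩
  have hind : LinearIndependent K ![w i, v] :=
    linearIndependent_finCons.2 ⟨linearIndependent_unique_iff.2 hv, hw i⟩
  have hind3 : LinearIndependent K ![w j, w i, v] := by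
    refine linearIndependent_finCons.2 ⟨hind, fun hmem => hij (hW (Subtype.ext ?_))⟩
    refine (Submodule.eq_of_le_of_finrank_eq ?_ ((W j).2.trans (W i).2.symm)).symm
    rw [← hspan j, Submodule.span_le]
    rintro _ ⟨k, rfl⟩
    fin_cases k
    · exact (hspan i).le hmem
    · exact hvW i
  convert hind3.comp ![2, 1, 0] (by decide) using 1
  ext k
  fin_cases k <;> rfl

theorem exists_not_dvd_X {σ : Type} [Nontrivial σ] {F : MvPolynomial σ K} (hF : Irreducible F) :
    ∃ i, ¬ F ∣ X i := by
  by_contra! h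
  obtain ⟨i, j, hij⟩ := exists_pair_ne σ
  have h1 : X i ∣ F := (hF.dvd_symm (MvPolynomial.X_prime.irreducible) (h i))
  exact hij (X_dvd_X.1 (h1.trans (h j)))

end glue

/-- if `X ⊆ ℙ⁴` is a threefold covered by lines whose Fano scheme is
generically reduced and of dimension `2`, then through a general point of `X` there pass
at most `6` lines contained in `X`. -/
theorem mu_le_six
    (K : Type) [Field K] [IsAlgClosed K] [CharZero K]
    (n : ℕ) (F : MvPolynomial (Fin 5) K)
    (hdeg : F.IsHomogeneous n) (hIrr : Irreducible F)
    (hcov : CoveredByLines K F) (hdim : HasGrDim K (fanoSet K F) 2)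
    (hred : FanoGenerallyReduced K F)
    (μ : ℕ) (hμ : HasMu K F μ) :
    μ ≤ 6 := by
  by_contra! hlt
  obtain ⟨G, ⟨x, hx, v₀, hv₀, hG⟩, hcard⟩ := hμ
  have hGF : ¬ F ∣ G := by
    rintro ⟨H, rfl⟩
    rw [map_mul, hx v₀ hv₀, zero_mul] at hG
    exact hG rfl
  obtain ⟨i, hi⟩ := exists_not_dvd_X hIrr
  have hGX : ¬ F ∣ G * X i := fun h => (hIrr.prime.dvd_or_dvd h).elim hGF hi
  obtain ⟨Ω, _, _, v, w, c, hind, hc, hline, hrel, hgen⟩ :=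
    exists_generic_line hIrr hGX fun v hv hvG => by
      rw [map_mul, eval_X] at hvG
      have hv0 : v ≠ 0 := by
        rintro rfl
        exact hvG (by simp)
      have hvmem : v ∈ (Projectivization.mk K v hv0).submodule := by
        rw [Projectivization.submodule_mk]
        exact Submodule.mem_span_singleton_self v
      have h7 := hcard _ (mk_mem_projZeros hdeg hv0 hv) ⟨v, hvmem, left_ne_zero_of_mul hvG⟩
      obtain ⟨t, ht, ht7⟩ := Set.exists_subset_card_eq (hlt.trans_eq h7.symm)
      have : Finite t := Set.finite_of_ncard_ne_zero (by omega)
      let W := (Finite.equivFinOfCardEq (show Nat.card t = 7 from ht7)).symm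
      obtain ⟨w, hwW, hw⟩ := exists_directions hv0 (fun i => (W i : Grass K 2 4))
        (Subtype.val_injective.comp W.injective) fun i => (ht (W i).2).2 hvmem
      exact exists_relation_of_seven_lines hdeg hw fun i s t =>
        eval_eq_zero_of_mem_fanoSet hdeg hv (ht (W i).2).1
          ((W i : Grass K 2 4).1.add_mem (Submodule.smul_mem _ s ((ht (W i).2).2 hvmem))
            (Submodule.smul_mem _ t (hwW i)))
  have hv : aeval v F = 0 := by simpa using hline 1 0
  obtain ⟨u, hu, hu0⟩ := exists_extra_direction hdeg hIrr hgen hv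
    (fun t => by simpa using hline 1 t) hind hc hrel
  exact false_of_extra_direction hdeg hred (ringKrullDim_le_six hcov ⟨x, hx⟩ hdim) hgen hline hu hu0
    ((algebraicIndependent_X (Fin 2) Ω).map' (f := IsScalarTower.toAlgHom Ω
      (MvPolynomial (Fin 2) Ω) (FractionRing (MvPolynomial (Fin 2) Ω)))
      (IsFractionRing.injective _ _))

end PaperLines
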